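/- arXiv:2212.08521 — 2 statements merged into one kernel-verified Lean document; each statement's English description precedes it below -/
import Mathlib

section
/- Let n ≥ 2 and let g : 𝔹ₙ → ℂ be a holomorphic function that is not identically zero. Then there exists a holomorphic function f : 𝔹ₙ → ℂ such that: (i) f⁻¹(0) = g⁻¹(0); (ii) Df(z) ≠ 0 at every point z ∈ g⁻¹(0) at which Dg(z) ≠ 0; and (iii) for every c ∈ ℂ with c ≠ 0 the level set f⁻¹(c) is complete, i.e., every divergent path γ : [0,1) → 𝔹ₙ with f(γ(t)) = c for all t has infinite length. (Alarcón: every closed complex hypersurface in 𝔹ₙ is the zero set of a holomorphic function all of whose other level sets are complete.) -/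
open Set Metric
open scoped ENNReal

noncomputable section

/-- A path `γ : [0,1) → E` is a divergent path in the open set `Ω` if it is continuous on
`[0,1)`, takes values in `Ω`, and eventually leaves every compact subset of `Ω`. -/
def DivergentPathIn {E : Type*} [TopologicalSpace E] (Ω : Set E) (γ : ℝ → E) : Prop :=
  ContinuousOn γ (Set.Ico 0 1) ∧
  (∀ t ∈ Set.Ico (0 : ℝ) 1, γ t ∈ Ω) ∧
  ∀ K : Set E, K ⊆ Ω → IsCompact K →
    ∃ t₀ ∈ Set.Ico (0 : ℝ) 1, ∀ t ∈ Set.Ico t₀ 1, γ t ∉ K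

lemma norm_div_add_le {a b : ℂ} {t : ℝ} (ht : t ≤ 1 / 2) (hb : b ≠ 0)
    (h : ‖a‖ ≤ t * ‖b‖) : ‖a / (a + b)‖ ≤ 2 * t := by
  have hb' : 0 < ‖b‖ := norm_pos_iff.2 hb
  have h1 : ‖b‖ - ‖a‖ ≤ ‖a + b‖ := by
    have := norm_sub_norm_le b (-a)
    rw [norm_neg, sub_neg_eq_add, add_comm b a] at this
    exact this
  have h2 : ‖b‖ / 2 ≤ ‖a + b‖ := by nlinarith
  rw [norm_div, div_le_iff₀ (by linarith)]
  have : 0 ≤ t := by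
    by_contra! ht
    nlinarith [norm_nonneg a]
  nlinarith

/-- The two sets `{‖w‖ ≤ 1, re w ≤ s}` and `{‖w‖ ≤ 1, b ≤ re w}`, glued together. -/
def splitDisc (s b : ℝ) : Set ℂ := {w | ‖w‖ ≤ 1 ∧ (w.re ≤ s ∨ b ≤ w.re)}

lemma isCompact_splitDisc (s b : ℝ) : IsCompact (splitDisc s b) := by
  have : splitDisc s b = closedBall 0 1 ∩ ({w | w.re ≤ s} ∪ {w | b ≤ w.re}) := by
    ext w; simp [splitDisc]
  rw [this]
  exact (isCompact_closedBall _ _).inter_right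
    ((isClosed_le Complex.continuous_re continuous_const).union
      (isClosed_le continuous_const Complex.continuous_re))

lemma normSq_sub_sub_one (w : ℂ) (a : ℝ) :
    ‖w - ((a - 1 : ℝ) : ℂ)‖ ^ 2 = ‖w - ((a + 1 : ℝ) : ℂ)‖ ^ 2 + 4 * (w.re - a) := by
  rw [← Complex.normSq_eq_norm_sq, ← Complex.normSq_eq_norm_sq, Complex.normSq_apply,
    Complex.normSq_apply]
  simp
  ring

open Polynomial in
/-- A special case of Runge's theorem: a polynomial can be close to `0` on the part of the unit disc
to the left of a vertical strip and close to `1` on the part to the right of it. -/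
lemma exists_polynomial_near_zero_near_one {s b : ℝ} (hs : 0 ≤ s) (hsb : s < b) (hb : b ≤ 1)
    {ε : ℝ} (hε : 0 < ε) :
    ∃ p : ℂ[X], (∀ w : ℂ, ‖w‖ ≤ 1 → w.re ≤ s → ‖p.eval w‖ ≤ ε) ∧
      (∀ w : ℂ, ‖w‖ ≤ 1 → b ≤ w.re → ‖p.eval w - 1‖ ≤ ε) := by
  set K := splitDisc s b with hK
  have : CompactSpace K := isCompact_iff_compactSpace.1 (isCompact_splitDisc s b)
  have : Nonempty K := ⟨⟨0, by simp [hK, splitDisc, hs]⟩⟩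
  set S : Subalgebra ℂ C(K, ℂ) := (polynomialFunctions K).topologicalClosure with hS
  have hcl : IsClosed (S : Set C(K, ℂ)) := Subalgebra.isClosed_topologicalClosure _
  have : CompleteSpace S := hcl.completeSpace_coe
  set x : S := ⟨toContinuousMapOnAlgHom K X, Subalgebra.le_topologicalClosure _
    ⟨X, trivial, rfl⟩⟩ with hx
  have hxK : ∀ w : K, (x : C(K, ℂ)) w = w := fun w => by simp [hx]
  set a : ℝ := (s + b) / 2 with ha
  have hspec : ∀ z ∈ spectrum ℂ x, z.re ≠ a := by
    intro z hz hza
    have hbd := Subalgebra.spectrum_isBounded_connectedComponentIn S x hz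
    have hconv : Convex ℝ {w : ℂ | w.re = a} := by
      exact convex_hyperplane (f := Complex.re) ⟨by simp, by simp⟩ a
    have hsub : {w : ℂ | w.re = a} ⊆ (spectrum ℂ (x : C(K, ℂ)))ᶜ := by
      intro w hw hw'
      rw [ContinuousMap.spectrum_eq_range] at hw'
      obtain ⟨y, rfl⟩ := hw'
      rw [hxK] at hw
      have := y.2
      simp only [mem_ofPred_eq] at hw
      rcases this.2 with h | h <;> rw [hw] at h <;> linarith
    have hsub' := hconv.isPreconnected.subset_connectedComponentIn hza hsub
    obtain ⟨R, hR⟩ := (hbd.subset hsub').exists_norm_le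
    have := hR (⟨a, |R| + 1⟩ : ℂ) rfl
    have h2 := Complex.abs_im_le_norm (⟨a, |R| + 1⟩ : ℂ)
    simp only at h2
    have h3 := le_abs_self (|R| + 1)
    have h4 := le_abs_self R
    linarith
  set δ := (b - s) / 2 with hδ
  set κ := 1 - 4 * δ / 9 with hκ
  have hκ0 : 0 ≤ κ := by rw [hκ]; linarith
  have hκ1 : κ < 1 := by rw [hκ]; linarith
  obtain ⟨k, hk⟩ := exists_pow_lt_of_lt_one (show 0 < min (1 / 2) (ε / 4) by positivity) hκ1
  have hk2 : κ ^ k ≤ 1 / 2 := hk.le.trans (min_le_left _ _)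
  have hk4 : κ ^ k ≤ ε / 4 := hk.le.trans (min_le_right _ _)
  have hk0 : k ≠ 0 := by rintro rfl; norm_num at hk2
  set A : ℂ[X] := (X - C ((a - 1 : ℝ) : ℂ)) ^ (2 * k) with hA
  set B : ℂ[X] := (X - C ((a + 1 : ℝ) : ℂ)) ^ (2 * k) with hB
  have hAn : ∀ w : ℂ, ‖A.eval w‖ = (‖w - ((a - 1 : ℝ) : ℂ)‖ ^ 2) ^ k := by
    intro w; simp only [hA, eval_pow, eval_sub, eval_X, eval_C, norm_pow, pow_mul]
  have hBn : ∀ w : ℂ, ‖B.eval w‖ = (‖w - ((a + 1 : ℝ) : ℂ)‖ ^ 2) ^ k := by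
    intro w; simp only [hB, eval_pow, eval_sub, eval_X, eval_C, norm_pow, pow_mul]
  have hunit : IsUnit (aeval x (A + B)) := by
    rw [← spectrum.zero_notMem_iff ℂ, spectrum.map_polynomial_aeval]
    rintro ⟨z, hz, hz0⟩
    refine hspec z hz ?_
    have h1 : A.eval z = - B.eval z := by
      simp only [eval_add] at hz0
      exact eq_neg_of_add_eq_zero_left hz0
    have h2 : ‖A.eval z‖ = ‖B.eval z‖ := by rw [h1, norm_neg]
    rw [hAn, hBn] at h2
    have := (pow_left_inj₀ (by positivity) (by positivity) hk0).1 h2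
    rw [normSq_sub_sub_one] at this
    linarith
  obtain ⟨v, hv⟩ := hunit.exists_right_inv
  set q : S := aeval x A * v with hq
  have haev : ∀ (P : ℂ[X]) (w : K), (aeval x P : S).1 w = P.eval (w : ℂ) := by
    intro P w
    have : (aeval x P : S).1 = aeval (x : C(K, ℂ)) P := by
      exact (Polynomial.aeval_algHom_apply S.val x P).symm
    rw [this, aeval_continuousMap_apply, hxK]
  have hqv : ∀ w : K, q.1 w = A.eval (w : ℂ) / (A.eval (w : ℂ) + B.eval (w : ℂ)) := by
    intro w
    have h1 : (aeval x (A + B)).1 w * v.1 w = 1 := by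
      have := congrArg (fun f : S => f.1 w) hv
      simpa using! this
    rw [haev, eval_add] at h1
    have h2 : q.1 w = A.eval (w : ℂ) * v.1 w := by
      rw [← haev]; rfl
    rw [h2, eq_div_iff (left_ne_zero_of_mul_eq_one h1)]
    linear_combination (A.eval (w : ℂ)) * h1
  obtain ⟨f, ⟨p, -, rfl⟩, hpq⟩ := Metric.mem_closure_iff.1 q.2 (ε / 2) (by positivity)
  have hpw : ∀ w : K, ‖q.1 w - p.eval (w : ℂ)‖ ≤ ε / 2 := by
    intro w
    have := (ContinuousMap.dist_apply_le_dist w).trans hpq.le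
    simpa [dist_eq_norm] using this
  have hlarge : ∀ w : ℂ, ‖w‖ ≤ 1 → ∀ c : ℝ, |c| ≤ 2 → ‖w - (c : ℂ)‖ ^ 2 ≤ 9 := by
    intro w hw c hc
    have : ‖w - (c : ℂ)‖ ≤ 3 := by
      refine (norm_sub_le _ _).trans ?_
      rw [Complex.norm_real, Real.norm_eq_abs]; linarith
    nlinarith [norm_nonneg (w - (c : ℂ))]
  refine ⟨p, fun w hw hws => ?_, fun w hw hws => ?_⟩
  · have hwK : w ∈ K := ⟨hw, Or.inl hws⟩
    have h1 := hpw ⟨w, hwK⟩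
    rw [hqv] at h1
    have h9 := hlarge w hw (a + 1) (by rw [abs_le]; constructor <;> linarith)
    have h2 : ‖w - ((a - 1 : ℝ) : ℂ)‖ ^ 2 ≤ κ * ‖w - ((a + 1 : ℝ) : ℂ)‖ ^ 2 := by
      rw [normSq_sub_sub_one, hκ]; nlinarith
    have hB0 : B.eval w ≠ 0 := by
      rw [← norm_ne_zero_iff, hBn]
      have := normSq_sub_sub_one w a
      have : 0 < ‖w - ((a + 1 : ℝ) : ℂ)‖ ^ 2 := by nlinarith [sq_nonneg ‖w - ((a - 1 : ℝ) : ℂ)‖]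
      positivity
    have h3 : ‖A.eval w‖ ≤ κ ^ k * ‖B.eval w‖ := by
      rw [hAn, hBn, ← mul_pow]
      exact pow_le_pow_left₀ (by positivity) h2 k
    have h4 := norm_div_add_le hk2 hB0 h3
    have h5 := norm_sub_norm_le (p.eval w) (A.eval w / (A.eval w + B.eval w))
    rw [norm_sub_rev] at h5
    simp only at h1
    linarith
  · have hwK : w ∈ K := ⟨hw, Or.inr hws⟩
    have h1 := hpw ⟨w, hwK⟩
    rw [hqv] at h1
    have h9 := hlarge w hw (a - 1) (by rw [abs_le]; constructor <;> linarith)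
    have h2 : ‖w - ((a + 1 : ℝ) : ℂ)‖ ^ 2 ≤ κ * ‖w - ((a - 1 : ℝ) : ℂ)‖ ^ 2 := by
      have := normSq_sub_sub_one w a
      rw [hκ]; nlinarith
    have hA0 : A.eval w ≠ 0 := by
      rw [← norm_ne_zero_iff, hAn]
      have := normSq_sub_sub_one w a
      have : 0 < ‖w - ((a - 1 : ℝ) : ℂ)‖ ^ 2 := by nlinarith [sq_nonneg ‖w - ((a + 1 : ℝ) : ℂ)‖]
      positivity
    have h3 : ‖B.eval w‖ ≤ κ ^ k * ‖A.eval w‖ := by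
      rw [hAn, hBn, ← mul_pow]
      exact pow_le_pow_left₀ (by positivity) h2 k
    have h4 := norm_div_add_le hk2 hA0 h3
    have h5 : A.eval w + B.eval w ≠ 0 := by
      intro h0
      have : B.eval w = - A.eval w := eq_neg_of_add_eq_zero_right h0
      rw [this, norm_neg] at h3
      have := norm_pos_iff.2 hA0
      nlinarith
    have h6 : p.eval w - 1 = (p.eval w - A.eval w / (A.eval w + B.eval w)) -
        B.eval w / (B.eval w + A.eval w) := by
      rw [add_comm (B.eval w)]; field_simp; ring
    rw [h6]
    refine (norm_sub_le _ _).trans ?_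
    rw [norm_sub_rev]
    simp only at h1
    linarith

section Labyrinth

variable {E : Type*} [NormedAddCommGroup E] [InnerProductSpace ℂ E]

/-- There are entire functions which are arbitrarily small on the closed ball of radius `s` and
whose real part is arbitrarily close to `-∞` on `L`. -/
def CanPushDown (s : ℝ) (L : Set E) : Prop :=
  ∀ ε : ℝ, 0 < ε → ∀ M : ℝ, ∃ h : E → ℂ, Differentiable ℂ h ∧
    (∀ z, ‖z‖ ≤ s → ‖h z‖ ≤ ε) ∧ ∀ z ∈ L, (h z).re ≤ -M

/-- A piece of the real hyperplane `re ⟪p, z⟫ = b`, for a unit vector `p`: the closed ball with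
centre `b p` and radius `η` inside this hyperplane. -/
def cap (p : E) (b η : ℝ) : Set E := {z | (inner ℂ p z).re = b ∧ ‖z‖ ^ 2 ≤ b ^ 2 + η ^ 2}

lemma CanPushDown.empty (s : ℝ) : CanPushDown s (∅ : Set E) := fun ε hε _ =>
  ⟨fun _ => 0, differentiable_const _, fun _ _ => by simpa using hε.le, by simp⟩

lemma CanPushDown.union [FiniteDimensional ℂ E] {s s' r : ℝ} {L L' : Set E} (hL : CanPushDown s L)
    (hL' : CanPushDown s' L') (hs : s ≤ s') (hLs : ∀ z ∈ L, ‖z‖ ≤ s') (hLr : ∀ z ∈ L', ‖z‖ ≤ r) :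
    CanPushDown s (L ∪ L') := by
  intro ε hε M
  obtain ⟨h₁, hd₁, hs₁, hm₁⟩ := hL (ε / 2) (by positivity) (M + 1)
  have : ProperSpace E := FiniteDimensional.proper ℂ E
  obtain ⟨C, hC⟩ := (isCompact_closedBall (0 : E) r).exists_bound_of_continuousOn
    hd₁.continuous.continuousOn
  obtain ⟨h₂, hd₂, hs₂, hm₂⟩ := hL' (min (ε / 2) 1) (by positivity) (M + C)
  refine ⟨fun z => h₁ z + h₂ z, hd₁.add hd₂, fun z hz => ?_, fun z hz => ?_⟩
  · have h1 := hs₁ z hz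
    have h2 := (hs₂ z (hz.trans hs)).trans (min_le_left _ _)
    exact (norm_add_le _ _).trans (by linarith)
  · rw [Complex.add_re]
    rcases hz with hz | hz
    · have h1 := hm₁ z hz
      have h2 := (hs₂ z (hLs z hz)).trans (min_le_right _ _)
      have h3 := Complex.re_le_norm (h₂ z)
      linarith
    · have h1 := hm₂ z hz
      have h2 := hC z (by simpa using hLr z hz)
      have h3 := Complex.re_le_norm (h₁ z)
      linarith

lemma canPushDown_iUnion_cap {F : Finset E} {s b η : ℝ} (hF : ∀ p ∈ F, ‖p‖ = 1) (hs : 0 ≤ s)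
    (hsb : s < b) (hbη : b ^ 2 + η ^ 2 ≤ 1)
    (hsep : ∀ p ∈ F, ∀ q ∈ F, p ≠ q → ∀ z ∈ cap p b η, (inner ℂ q z).re ≤ s) :
    CanPushDown s (⋃ p ∈ F, cap p b η) := by
  intro ε hε M
  have hb : b ≤ 1 := by nlinarith [sq_nonneg η]
  set N : ℝ := (F.card : ℝ) with hN
  have hN0 : 0 ≤ N := Nat.cast_nonneg _
  set A : ℝ := 2 * (|M| + 1) with hA
  have hA0 : 0 < A := by positivity
  set ε' : ℝ := min (ε / A) (1 / 2) / (N + 1) with hε'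
  have hε'0 : 0 < ε' := by positivity
  have hNε : N * ε' ≤ min (ε / A) (1 / 2) := by
    calc N * ε' ≤ (N + 1) * ε' := by nlinarith
      _ = _ := by rw [hε']; field_simp
  have hs1 : s ≤ 1 := hsb.le.trans hb
  obtain ⟨P, hP0, hP1⟩ := exists_polynomial_near_zero_near_one hs hsb hb hε'0
  have hin : ∀ q ∈ F, ∀ z : E, ‖z‖ ≤ 1 → ‖inner ℂ q z‖ ≤ 1 := fun q hq z hz => by
    have := norm_inner_le_norm (𝕜 := ℂ) q z
    rw [hF q hq, one_mul] at this
    exact this.trans hz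
  refine ⟨fun z => -A * ∑ p ∈ F, P.eval (inner ℂ p z), ?_, fun z hz => ?_, fun z hz => ?_⟩
  · refine (Differentiable.fun_sum fun p _ => ?_).const_mul _
    exact P.differentiable.comp (innerSL ℂ p).differentiable
  · rw [norm_mul, norm_neg, Complex.norm_real, Real.norm_of_nonneg hA0.le]
    have h1 : ‖∑ p ∈ F, P.eval (inner ℂ p z)‖ ≤ N * ε' := by
      rw [hN, ← nsmul_eq_mul]
      refine (norm_sum_le_of_le F fun p hp => ?_).trans (Finset.sum_const _).le
      refine hP0 _ (hin p hp z (hz.trans hs1)) ?_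
      refine (Complex.re_le_norm _).trans ((norm_inner_le_norm (𝕜 := ℂ) p z).trans ?_)
      rwa [hF p hp, one_mul]
    calc A * _ ≤ A * (ε / A) :=
          mul_le_mul_of_nonneg_left (h1.trans (hNε.trans (min_le_left _ _))) hA0.le
      _ = ε := by field_simp
  · classical
    simp only [mem_iUnion] at hz
    obtain ⟨p, hp, hz⟩ := hz
    have hz1 : ‖z‖ ≤ 1 := by
      have := hz.2.trans hbη
      nlinarith [norm_nonneg z]
    have h1 : ‖(∑ q ∈ F, P.eval (inner ℂ q z)) - 1‖ ≤ N * ε' := by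
      rw [← Finset.add_sum_erase F _ hp, add_sub_right_comm]
      refine (norm_add_le _ _).trans ?_
      have h2 : ‖P.eval (inner ℂ p z) - 1‖ ≤ ε' := hP1 _ (hin p hp z hz1) hz.1.ge
      have h3 : ‖∑ q ∈ F.erase p, P.eval (inner ℂ q z)‖ ≤ (F.erase p).card • ε' := by
        refine (norm_sum_le_of_le _ fun q hq => ?_).trans (Finset.sum_const _).le
        obtain ⟨hqp, hq⟩ := Finset.mem_erase.1 hq
        exact hP0 _ (hin q hq z hz1) (hsep p hp q hq hqp.symm z hz)
      have h4 : ((F.erase p).card : ℝ) + 1 = N := by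
        rw [hN]; exact_mod_cast Finset.card_erase_add_one hp
      rw [nsmul_eq_mul] at h3
      rw [← h4]
      linarith
    have h2 := (Complex.abs_re_le_norm _).trans (h1.trans (hNε.trans (min_le_right _ _)))
    rw [Complex.sub_re, Complex.one_re, abs_le] at h2
    have h3 : (-(A : ℂ) * ∑ q ∈ F, P.eval (inner ℂ q z)).re =
        -A * (∑ q ∈ F, P.eval (inner ℂ q z)).re := by
      rw [← Complex.ofReal_neg, Complex.re_ofReal_mul]
    rw [h3]
    have := le_abs_self M
    nlinarith [abs_nonneg M]

lemma re_inner_eq_of_norm_eq_one {p q : E} (hp : ‖p‖ = 1) (hq : ‖q‖ = 1) :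
    (inner ℂ p q).re = 1 - ‖p - q‖ ^ 2 / 2 := by
  have := norm_sub_sq (𝕜 := ℂ) p q
  rw [hp, hq] at this
  simp only [RCLike.re_to_complex] at this
  linarith

lemma norm_sub_ofReal_smul_sq {p : E} (hp : ‖p‖ = 1) (z : E) (r : ℝ) :
    ‖z - (r : ℂ) • p‖ ^ 2 = ‖z‖ ^ 2 - 2 * r * (inner ℂ p z).re + r ^ 2 := by
  have := norm_sub_sq (𝕜 := ℂ) z ((r : ℂ) • p)
  rw [this, inner_smul_right, norm_smul, hp, ← inner_conj_symm z p]
  simp only [RCLike.re_to_complex, Complex.re_ofReal_mul, Complex.norm_real, mul_one,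
    Real.norm_eq_abs, sq_abs, Complex.conj_re]
  ring

lemma re_inner_le_of_mem_cap {p q z : E} {b η : ℝ} (hp : ‖p‖ = 1) (hq : ‖q‖ = 1) (hη : 0 ≤ η)
    (hz : z ∈ cap p b η) :
    (inner ℂ q z).re ≤ b - b * ‖p - q‖ ^ 2 / 2 + ‖p - q‖ * η := by
  have h1 : ‖z - (b : ℂ) • p‖ ≤ η := by
    have := norm_sub_ofReal_smul_sq hp z b
    rw [hz.1] at this
    have h2 := hz.2
    exact abs_le_of_sq_le_sq' (by nlinarith) hη |>.2
  have h2 : inner ℂ q z = inner ℂ (q - p) (z - (b : ℂ) • p) + inner ℂ p z +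
      b * inner ℂ q p - b * inner ℂ p p := by
    simp only [inner_sub_left, inner_sub_right, inner_smul_right]; ring
  have h3 : (inner ℂ (q - p) (z - (b : ℂ) • p)).re ≤ ‖p - q‖ * η := by
    refine (Complex.re_le_norm _).trans ((norm_inner_le_norm (𝕜 := ℂ) _ _).trans ?_)
    rw [norm_sub_rev q p]
    gcongr
  rw [h2, Complex.sub_re, Complex.add_re, Complex.add_re, Complex.re_ofReal_mul,
    Complex.re_ofReal_mul, re_inner_eq_of_norm_eq_one hq hp, re_inner_eq_of_norm_eq_one hp hp, hz.1,
    sub_self, norm_zero, norm_sub_rev q p]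
  linarith

lemma exists_mem_cap_of_path {p : E} {b η ρ C : ℝ} (hp : ‖p‖ = 1) (hC : 0 ≤ C) (hρ : 0 < ρ)
    (hη : (C + 1) * ρ ≤ η) {γ : ℝ → E} {t₀ t₁ : ℝ} (ht : t₀ ≤ t₁)
    (hγ : ContinuousOn γ (Icc t₀ t₁)) (h₀ : ‖γ t₀‖ ≤ b) (hb : 0 < b) (h₁ : b + η ^ 2 ≤ ‖γ t₁‖)
    (h₁' : ‖γ t₁‖ ≤ 1) (hclose : ∀ t ∈ Icc t₀ t₁, ‖γ t - γ t₁‖ < ρ)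
    (hpu : ‖p - ((‖γ t₁‖⁻¹ : ℝ) : ℂ) • γ t₁‖ ≤ C * ρ) :
    ∃ t ∈ Icc t₀ t₁, γ t ∈ cap p b η := by
  set x := γ t₁ with hx
  have hCρ : 0 ≤ C * ρ := by positivity
  have hx0 : 0 < ‖x‖ := by nlinarith [sq_nonneg η]
  set u := ((‖x‖⁻¹ : ℝ) : ℂ) • x with hu
  have hxu : x = (‖x‖ : ℂ) • u := by
    rw [hu, smul_smul, ← Complex.ofReal_mul, mul_inv_cancel₀ hx0.ne', Complex.ofReal_one, one_smul]
  have hu1 : ‖u‖ = 1 := by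
    rw [hu, norm_smul, Complex.norm_real, norm_inv, norm_norm, inv_mul_cancel₀ hx0.ne']
  have hend : b ≤ (inner ℂ p x).re := by
    have h1 : (inner ℂ p x).re = ‖x‖ * (1 - ‖p - u‖ ^ 2 / 2) := by
      conv_lhs => rw [hxu]
      rw [inner_smul_right, Complex.re_ofReal_mul, re_inner_eq_of_norm_eq_one hp hu1]
    have h2 : ‖p - u‖ ^ 2 ≤ η ^ 2 := by
      gcongr; nlinarith
    rw [h1]
    nlinarith [sq_nonneg η, sq_nonneg ‖p - u‖]
  have hstart : (inner ℂ p (γ t₀)).re ≤ b := by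
    refine (Complex.re_le_norm _).trans ((norm_inner_le_norm (𝕜 := ℂ) _ _).trans ?_)
    rwa [hp, one_mul]
  have hcont : ContinuousOn (fun t => (inner ℂ p (γ t)).re) (Icc t₀ t₁) :=
    Complex.continuous_re.comp_continuousOn ((innerSL ℂ p).continuous.comp_continuousOn hγ)
  obtain ⟨t, ht, htb⟩ := intermediate_value_Icc ht hcont ⟨hstart, hend⟩
  refine ⟨t, ht, htb, ?_⟩
  have h1 : ‖γ t - (‖x‖ : ℂ) • p‖ ≤ η := by
    have h2 : γ t - (‖x‖ : ℂ) • p = (γ t - x) - (‖x‖ : ℂ) • (p - u) := by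
      rw [smul_sub, ← hxu]; abel
    rw [h2]
    refine (norm_sub_le _ _).trans ?_
    rw [norm_smul, Complex.norm_real, norm_norm]
    have := hclose t ht
    nlinarith [norm_nonneg (p - u)]
  have h2 := norm_sub_ofReal_smul_sq hp (γ t) ‖x‖
  simp only at htb
  rw [htb] at h2
  have h3 : ‖γ t - (‖x‖ : ℂ) • p‖ ^ 2 ≤ η ^ 2 := by gcongr
  nlinarith [sq_nonneg (‖x‖ - b)]

end Labyrinth

section Families

variable {n : ℕ}

/-- The index of the cube of side `ρ` containing `x`, in the cubical grid of `ℂⁿ = ℝ²ⁿ`. -/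
def gridCell (ρ : ℝ) (x : EuclideanSpace ℂ (Fin n)) : Fin n → ℤ × ℤ :=
  fun i => (⌊(x i).re / ρ⌋, ⌊(x i).im / ρ⌋)

lemma abs_sub_le_of_floor_eq {ρ a b : ℝ} (hρ : 0 < ρ) (h : ⌊a / ρ⌋ = ⌊b / ρ⌋) : |a - b| ≤ ρ := by
  have := (Int.abs_sub_lt_one_of_floor_eq_floor h).le
  rw [← sub_div, abs_div, abs_of_pos hρ, div_le_one hρ] at this
  exact this

lemma norm_sub_le_of_gridCell_eq {ρ : ℝ} (hρ : 0 < ρ) {x y : EuclideanSpace ℂ (Fin n)}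
    (h : gridCell ρ x = gridCell ρ y) : ‖x - y‖ ≤ 2 * n * ρ := by
  have hc : ∀ i, ‖(x - y) i‖ ^ 2 ≤ (2 * ρ) ^ 2 := fun i => by
    have h1 := congrFun h i
    simp only [gridCell, Prod.mk.injEq] at h1
    have h2 := Complex.norm_le_abs_re_add_abs_im ((x - y) i)
    have h3 := abs_sub_le_of_floor_eq hρ h1.1
    have h4 := abs_sub_le_of_floor_eq hρ h1.2
    rw [PiLp.sub_apply, Complex.sub_re, Complex.sub_im] at h2
    rw [PiLp.sub_apply]
    gcongr
    linarith
  have h2 : ‖x - y‖ ^ 2 ≤ (2 * n * ρ) ^ 2 := by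
    rw [EuclideanSpace.norm_sq_eq]
    refine (Finset.sum_le_card_nsmul _ _ _ fun i _ => hc i).trans ?_
    rw [Finset.card_univ, Fintype.card_fin, nsmul_eq_mul]
    have : (n : ℝ) ≤ n ^ 2 := by exact_mod_cast Nat.le_self_pow two_ne_zero n
    nlinarith [sq_nonneg ρ]
  exact abs_le_of_sq_le_sq' h2 (by positivity) |>.2

lemma mul_le_abs_sub_of_floor_ne {N : ℕ} {ρ a b : ℝ} (hρ : 0 < ρ) (h : ⌊a / ρ⌋ ≠ ⌊b / ρ⌋)
    (hN : (⌊a / ρ⌋ : ZMod N) = (⌊b / ρ⌋ : ZMod N)) : ((N : ℝ) - 1) * ρ ≤ |a - b| := by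
  have h1 : (N : ℤ) ≤ |⌊a / ρ⌋ - ⌊b / ρ⌋| := by
    refine Int.le_of_dvd (abs_pos.2 (sub_ne_zero.2 h)) ((dvd_abs _ _).2 ?_)
    rw [← ZMod.intCast_zmod_eq_zero_iff_dvd]
    push_cast
    rw [hN, sub_self]
  have h2 : (N : ℝ) ≤ |(⌊a / ρ⌋ : ℝ) - ⌊b / ρ⌋| := by exact_mod_cast h1
  have h3 : (N : ℝ) - 1 ≤ |a / ρ - b / ρ| := by
    have ha := Int.floor_le (a / ρ)
    have ha' := Int.lt_floor_add_one (a / ρ)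
    have hb := Int.floor_le (b / ρ)
    have hb' := Int.lt_floor_add_one (b / ρ)
    rcases le_abs'.1 h2 with h | h
    · exact le_abs'.2 (Or.inl (by linarith))
    · exact le_abs'.2 (Or.inr (by linarith))
  rwa [← sub_div, abs_div, abs_of_pos hρ, le_div_iff₀ hρ] at h3

lemma mul_le_norm_sub_of_gridCell_ne {N : ℕ} {ρ : ℝ} (hρ : 0 < ρ)
    {x y : EuclideanSpace ℂ (Fin n)} (h : gridCell ρ x ≠ gridCell ρ y)
    (hN : ∀ i, ((gridCell ρ x i).1 : ZMod N) = ((gridCell ρ y i).1 : ZMod N) ∧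
      ((gridCell ρ x i).2 : ZMod N) = ((gridCell ρ y i).2 : ZMod N)) :
    ((N : ℝ) - 1) * ρ ≤ ‖x - y‖ := by
  obtain ⟨i, hi⟩ := Function.ne_iff.1 h
  refine le_trans ?_ (PiLp.norm_apply_le (x - y) i)
  rw [PiLp.sub_apply]
  by_cases h1 : (gridCell ρ x i).1 = (gridCell ρ y i).1
  · have h2 : (gridCell ρ x i).2 ≠ (gridCell ρ y i).2 := fun h2 => hi (Prod.ext h1 h2)
    refine (mul_le_abs_sub_of_floor_ne hρ h2 (hN i).2).trans ?_
    rw [← Complex.sub_im]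
    exact Complex.abs_im_le_norm _
  · refine (mul_le_abs_sub_of_floor_ne hρ h1 (hN i).1).trans ?_
    rw [← Complex.sub_re]
    exact Complex.abs_re_le_norm _

/-- A net of mesh comparable to `ρ` in the unit sphere of `ℂⁿ` splits into boundedly many
`D ρ`-separated families, with a bound independent of `ρ`. -/
lemma exists_separated_families (n : ℕ) (D : ℝ) :
    ∃ m : ℕ, ∀ ρ : ℝ, 0 < ρ → ∃ F : ℕ → Finset (EuclideanSpace ℂ (Fin n)),
      (∀ i, ∀ p ∈ F i, ‖p‖ = 1) ∧
      (∀ i, ∀ p ∈ F i, ∀ q ∈ F i, p ≠ q → D * ρ ≤ ‖p - q‖) ∧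
      ∀ u : EuclideanSpace ℂ (Fin n), ‖u‖ = 1 → ∃ i < m, ∃ p ∈ F i, ‖p - u‖ ≤ (2 * n + 1) * ρ := by
  classical
  set N : ℕ := ⌈D⌉₊ + 1 with hN
  have : NeZero N := ⟨by omega⟩
  let color : (Fin n → ℤ × ℤ) → (Fin n → ZMod N × ZMod N) := fun c i => ((c i).1, (c i).2)
  let e := Fintype.equivFin (Fin n → ZMod N × ZMod N)
  refine ⟨Fintype.card (Fin n → ZMod N × ZMod N), fun ρ hρ => ?_⟩
  obtain ⟨T, hTsub, hTfin, hT⟩ := Metric.finite_approx_of_totallyBounded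
    (isCompact_sphere (0 : EuclideanSpace ℂ (Fin n)) 1).totallyBounded ρ hρ
  let rep : EuclideanSpace ℂ (Fin n) → EuclideanSpace ℂ (Fin n) :=
    fun x => Function.invFunOn (gridCell ρ) T (gridCell ρ x)
  have hrepT : ∀ x ∈ T, rep x ∈ T := fun x hx => Function.invFunOn_mem ⟨x, hx, rfl⟩
  have hrepc : ∀ x ∈ T, gridCell ρ (rep x) = gridCell ρ x :=
    fun x hx => Function.invFunOn_eq ⟨x, hx, rfl⟩
  have hreprep : ∀ x ∈ T, rep (rep x) = rep x := fun x hx => by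
    simp only [rep]; rw [hrepc x hx]
  refine ⟨fun i => hTfin.toFinset.filter
    fun x => rep x = x ∧ (e (color (gridCell ρ x)) : ℕ) = i, ?_, ?_, ?_⟩
  · intro i p hp
    simp only [Finset.mem_filter, Set.Finite.mem_toFinset] at hp
    simpa using hTsub hp.1
  · intro i p hp q hq hpq
    simp only [Finset.mem_filter, Set.Finite.mem_toFinset] at hp hq
    have hcell : gridCell ρ p ≠ gridCell ρ q := by
      intro h
      apply hpq
      rw [← hp.2.1, ← hq.2.1]
      simp only [rep]; rw [h]
    have hcol : color (gridCell ρ p) = color (gridCell ρ q) :=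
      e.injective (Fin.ext (hp.2.2.trans hq.2.2.symm))
    have h1 := mul_le_norm_sub_of_gridCell_ne (N := N) hρ hcell
      fun j => Prod.mk.inj (congrFun hcol j)
    refine le_trans ?_ h1
    gcongr
    rw [hN]; push_cast
    linarith [Nat.le_ceil D]
  · intro u hu
    have hu' : u ∈ sphere (0 : EuclideanSpace ℂ (Fin n)) 1 := by simpa using hu
    obtain ⟨x, hxT, hxu⟩ := mem_iUnion₂.1 (hT hu')
    refine ⟨_, (e (color (gridCell ρ (rep x)))).2, rep x, ?_, ?_⟩
    · simp only [Finset.mem_filter, Set.Finite.mem_toFinset]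
      exact ⟨hrepT x hxT, hreprep x hxT, trivial⟩
    · have h1 := norm_sub_le_of_gridCell_eq hρ (hrepc x hxT)
      have h2 : dist u x < ρ := hxu
      rw [dist_comm, dist_eq_norm] at h2
      have h3 := norm_sub_le_norm_sub_add_norm_sub (rep x) x u
      linarith

/-- In a thin spherical shell of thickness comparable to `ρ ^ 2` there is a set `L` on which entire
functions can be pushed down, such that paths crossing the shell without meeting `L` have to make a
detour of size `ρ`. -/
lemma exists_labyrinth (n : ℕ) :
    ∃ Q : ℝ, 1 ≤ Q ∧ ∀ ρ s s' : ℝ, 0 < ρ → 1 / 2 ≤ s → s + Q * ρ ^ 2 ≤ s' → s' ≤ 1 →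
      ∃ L : Set (EuclideanSpace ℂ (Fin n)), (∀ z ∈ L, ‖z‖ ≤ s') ∧ CanPushDown s L ∧
        ∀ (γ : ℝ → EuclideanSpace ℂ (Fin n)) (t₀ t₁ : ℝ), t₀ ≤ t₁ → ContinuousOn γ (Icc t₀ t₁) →
          ‖γ t₀‖ ≤ s → s' ≤ ‖γ t₁‖ → ‖γ t₁‖ ≤ 1 → (∀ t ∈ Icc t₀ t₁, γ t ∉ L) →
          ∃ t ∈ Icc t₀ t₁, ρ ≤ ‖γ t - γ t₁‖ := by
  set C : ℝ := 2 * n + 1 with hC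
  have hC0 : 0 ≤ C := by positivity
  obtain ⟨m, hm⟩ := exists_separated_families n (4 * (C + 2))
  refine ⟨m * (1 + (C + 1) ^ 2) + 1,
    by nlinarith [show (0 : ℝ) ≤ m * (1 + (C + 1) ^ 2) by positivity],
    fun ρ s s' hρ hs hss' hs' => ?_⟩
  obtain ⟨F, hF1, hFsep, hFnet⟩ := hm ρ hρ
  set η := (C + 1) * ρ with hη
  have hη0 : 0 < η := by positivity
  set r : ℕ → ℝ := fun i => s + i * (ρ ^ 2 + η ^ 2) with hr
  have hr_succ : ∀ i, r (i + 1) = r i + ρ ^ 2 + η ^ 2 := fun i => by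
    simp only [hr]; push_cast; ring
  have hr_mono : Monotone r := monotone_nat_of_le_succ fun i => by
    rw [hr_succ]; nlinarith [sq_nonneg ρ, sq_nonneg η]
  have hr0 : r 0 = s := by simp [hr]
  have hrm : r m ≤ s' := by
    refine le_trans ?_ hss'
    simp only [hr, hη]; nlinarith [sq_nonneg ρ]
  have hrs : ∀ i, 1 / 2 ≤ r i := fun i => hs.trans (hr0 ▸ hr_mono (Nat.zero_le i))
  set b : ℕ → ℝ := fun i => r i + ρ ^ 2 with hb
  have hrb : ∀ i, r i < b i := fun i => by simp only [hb]; nlinarith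
  have hb_sq : ∀ i, b i ^ 2 + η ^ 2 ≤ r (i + 1) ^ 2 := fun i => by
    have h1 : r (i + 1) = b i + η ^ 2 := hr_succ i
    rw [h1]; nlinarith [hrs i, hrb i, sq_nonneg (η ^ 2), sq_nonneg η]
  have hr1 : ∀ i < m, r (i + 1) ≤ 1 := fun i hi => ((hr_mono hi).trans hrm).trans hs'
  set W : ℕ → Set (EuclideanSpace ℂ (Fin n)) := fun i => ⋃ p ∈ F i, cap p (b i) η with hW
  have hWr : ∀ i, ∀ z ∈ W i, ‖z‖ ≤ r (i + 1) := by
    intro i z hz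
    simp only [hW, mem_iUnion] at hz
    obtain ⟨p, -, hz⟩ := hz
    exact abs_le_of_sq_le_sq' (hz.2.trans (hb_sq i)) (by linarith [hrs (i + 1)]) |>.2
  have hWpush : ∀ i < m, CanPushDown (r i) (W i) := by
    intro i hi
    refine canPushDown_iUnion_cap (hF1 i) (by linarith [hrs i]) (hrb i)
      ((hb_sq i).trans ?_) ?_
    · have := hr1 i hi
      nlinarith [hrs (i + 1)]
    · intro p hp q hq hpq z hz
      refine (re_inner_le_of_mem_cap (hF1 i p hp) (hF1 i q hq) hη0.le hz).trans ?_
      have hd := hFsep i p hp q hq hpq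
      have hbi : 1 / 2 ≤ b i := by linarith [hrs i, hrb i]
      set d := ‖p - q‖
      have h1 : ρ ^ 2 ≤ d * (d / 4 - η) := by
        have h2 : ρ ≤ d / 4 - η := by rw [hη]; linarith
        have h3 : ρ ≤ d := by nlinarith
        nlinarith
      have h4 : d ^ 2 / 4 ≤ b i * d ^ 2 / 2 := by nlinarith [sq_nonneg d]
      have h5 : r i = b i - ρ ^ 2 := by simp only [hb]; ring
      rw [h5]; nlinarith
  refine ⟨⋃ i ∈ Finset.range m, W i, ?_, ?_, ?_⟩
  · intro z hz
    simp only [mem_iUnion, Finset.mem_range] at hz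
    obtain ⟨i, hi, hz⟩ := hz
    exact (hWr i z hz).trans ((hr_mono hi).trans hrm)
  · have key : ∀ k ≤ m, CanPushDown s (⋃ i ∈ Finset.range k, W i) := by
      intro k
      induction k with
      | zero => intro _; simpa using CanPushDown.empty s
      | succ k ih =>
        intro hk
        rw [Finset.range_add_one, Finset.set_biUnion_insert, union_comm]
        refine (ih (by omega)).union (hWpush k hk) (hr0 ▸ hr_mono (Nat.zero_le k)) ?_ (hWr k)
        intro z hz
        simp only [mem_iUnion, Finset.mem_range] at hz
        obtain ⟨i, hi, hz⟩ := hz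
        exact (hWr i z hz).trans (hr_mono hi)
    exact key m le_rfl
  · intro γ t₀ t₁ ht hγ h₀ h₁ h₁' hL
    by_contra! hclose
    have hx0 : 0 < ‖γ t₁‖ := by linarith [hrs m]
    obtain ⟨i, hi, p, hp, hpu⟩ := hFnet (((‖γ t₁‖⁻¹ : ℝ) : ℂ) • γ t₁) (by
      rw [norm_smul, Complex.norm_real, norm_inv, norm_norm, inv_mul_cancel₀ hx0.ne'])
    have hbi : s ≤ b i := (hr0 ▸ hr_mono (Nat.zero_le i) : s ≤ r i).trans (hrb i).le
    obtain ⟨t, ht, htc⟩ := exists_mem_cap_of_path (hF1 i p hp) hC0 hρ le_rfl ht hγ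
      (h₀.trans hbi) (by linarith)
      (((hr_succ i).symm.le.trans (hr_mono hi)).trans (hrm.trans h₁)) h₁' hclose hpu
    refine hL t ht ?_
    simp only [mem_iUnion, Finset.mem_range]
    exact ⟨i, hi, mem_iUnion₂.2 ⟨p, hp, htc⟩⟩

end Families

section Limit

variable {E : Type*} [NormedAddCommGroup E] [NormedSpace ℂ E]

lemma differentiableOn_ball_tsum {h : ℕ → E → ℂ} {r : ℕ → ℝ} (hd : ∀ k, Differentiable ℂ (h k))
    (hr : Filter.Tendsto r Filter.atTop (nhds 1))
    (hh : ∀ k z, ‖z‖ ≤ r k → ‖h k z‖ ≤ (1 / 2) ^ k) :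
    DifferentiableOn ℂ (fun z => ∑' k, h k z) (ball 0 1) := by
  intro z₀ hz₀
  rw [mem_ball_zero_iff] at hz₀
  set R := (‖z₀‖ + 1) / 2 with hR
  set R' := (R + 1) / 2 with hR'
  have hR1 : R < 1 := by linarith
  have hR0 : 0 < R := by linarith [norm_nonneg z₀]
  obtain ⟨K, hK⟩ := Filter.eventually_atTop.1 (hr.eventually (lt_mem_nhds (show R' < 1 by linarith)))
  have hδ : 0 < R' - R := by linarith
  have hsmall : ∀ k z, ‖z‖ < R' → ‖h (k + K) z‖ ≤ (1 / 2) ^ k := fun k z hz =>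
    (hh (k + K) z (hz.le.trans (hK _ (by omega)).le)).trans
      (pow_le_pow_of_le_one (by norm_num) (by norm_num) (by omega))
  have hderiv : ∀ k, ∀ z ∈ ball (0 : E) R,
      ‖fderiv ℂ (h (k + K)) z‖ ≤ (2 / (R' - R)) * (1 / 2) ^ k := by
    intro k z hz
    rw [mem_ball_zero_iff] at hz
    have := Complex.norm_fderiv_le_div_of_mapsTo_ball (f := h (k + K)) (c := z) (R₁ := R' - R)
      (R₂ := 2 * (1 / 2) ^ k) (hd _).differentiableOn (fun w hw => ?_) hδ
    · refine this.trans_eq ?_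
      ring
    · rw [mem_ball, dist_eq_norm] at hw
      have hw' : ‖w‖ < R' := by
        have := norm_le_norm_add_norm_sub' w z
        linarith
      rw [mem_closedBall, dist_eq_norm]
      refine (norm_sub_le _ _).trans ?_
      linarith [hsmall k w hw', hsmall k z (by linarith)]
  have hgeo : Summable fun k : ℕ => (1 / 2 : ℝ) ^ k := summable_geometric_two
  have hsum : ∀ z, ‖z‖ < R' → Summable fun k => h (k + K) z := fun z hz =>
    Summable.of_norm_bounded hgeo fun k => hsmall k z hz
  have htail := hasFDerivAt_tsum_of_isPreconnected (f := fun k => h (k + K)) (x₀ := 0) (x := z₀)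
    (hgeo.mul_left (2 / (R' - R))) isOpen_ball
    (convex_ball (0 : E) R).isPreconnected (fun k z _ => (hd (k + K) z).hasFDerivAt) hderiv
    (mem_ball_self hR0) (hsum 0 (by rw [norm_zero]; linarith))
    (by rw [mem_ball_zero_iff]; linarith)
  have hhead : DifferentiableAt ℂ (fun z => ∑ k ∈ Finset.range K, h k z) z₀ :=
    DifferentiableAt.fun_sum fun k _ => hd k z₀
  refine DifferentiableAt.differentiableWithinAt ?_
  refine (hhead.add htail.differentiableAt).congr_of_eventuallyEq ?_
  filter_upwards [isOpen_ball.mem_nhds (show z₀ ∈ ball (0 : E) R by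
    rw [mem_ball_zero_iff]; linarith)] with z hz
  rw [mem_ball_zero_iff] at hz
  exact (((summable_nat_add_iff K).1 (hsum z (by linarith))).sum_add_tsum_nat_add K).symm

/-- Successively pushing down on sets `L k` contained in balls exhausting the unit ball, one
makes a holomorphic function small on all of them, without changing its zeros. -/
lemma exists_exp_factor [ProperSpace E] {g : E → ℂ}
    (hg : ContinuousOn g (ball 0 1)) {r : ℕ → ℝ} (hr : Filter.Tendsto r Filter.atTop (nhds 1))
    (hrm : Monotone r) (hr1 : ∀ k, r k < 1) {L : ℕ → Set E} (hL : ∀ k, ∀ z ∈ L k, ‖z‖ ≤ r (k + 1))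
    (hpush : ∀ k, ∀ ε : ℝ, 0 < ε → ∀ M : ℝ, ∃ h : E → ℂ, Differentiable ℂ h ∧
      (∀ z, ‖z‖ ≤ r k → ‖h z‖ ≤ ε) ∧ ∀ z ∈ L k, (h z).re ≤ -M) :
    ∃ H : E → ℂ, DifferentiableOn ℂ H (ball 0 1) ∧
      ∀ k, ∀ z ∈ L k, ‖g z * Complex.exp (H z)‖ ≤ Real.exp 2 * (1 / 2) ^ k := by
  have step : ∀ (k : ℕ) (G : {G : E → ℂ // Differentiable ℂ G}), ∃ h : E → ℂ, Differentiable ℂ h ∧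
      (∀ z, ‖z‖ ≤ r k → ‖h z‖ ≤ (1 / 2) ^ k) ∧
      ∀ z ∈ L k, ‖g z * Complex.exp (G.1 z + h z)‖ ≤ (1 / 2) ^ k := by
    intro k G
    have hsub : closedBall (0 : E) (r (k + 1)) ⊆ ball 0 1 := closedBall_subset_ball (hr1 _)
    obtain ⟨A, hA⟩ := (isCompact_closedBall (0 : E) (r (k + 1))).exists_bound_of_continuousOn
      ((hg.mono hsub).mul (Complex.continuous_exp.comp G.2.continuous).continuousOn)
    obtain ⟨h, hd, hs, hm⟩ := hpush k ((1 / 2) ^ k) (by positivity)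
      (Real.log ((|A| + 1) * 2 ^ k))
    refine ⟨h, hd, hs, fun z hz => ?_⟩
    have h1 := hA z (by simpa using hL k z hz)
    have h2 : ‖Complex.exp (h z)‖ ≤ ((|A| + 1) * 2 ^ k)⁻¹ := by
      rw [Complex.norm_exp]
      refine (Real.exp_le_exp.2 (hm z hz)).trans ?_
      rw [Real.exp_neg, Real.exp_log (by positivity)]
    rw [Complex.exp_add, ← mul_assoc, norm_mul]
    calc _ ≤ (|A| + 1) * ((|A| + 1) * 2 ^ k)⁻¹ := by
          gcongr
          exact h1.trans ((le_abs_self A).trans (by linarith))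
      _ = (1 / 2) ^ k := by
          have : |A| + 1 ≠ 0 := by positivity
          rw [mul_inv, ← mul_assoc, mul_inv_cancel₀ this, one_mul, one_div, inv_pow]
  choose h hd hs hm using step
  let G : ℕ → {G : E → ℂ // Differentiable ℂ G} := fun k =>
    Nat.rec ⟨fun _ => 0, differentiable_const _⟩
      (fun k G => ⟨fun z => G.1 z + h k G z, G.2.add (hd k G)⟩) k
  have hGsum : ∀ k z, (G k).1 z = ∑ j ∈ Finset.range k, h j (G j) z := by
    intro k z
    induction k with
    | zero => rfl
    | succ k ih => rw [Finset.sum_range_succ, ← ih]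
  refine ⟨fun z => ∑' k, h k (G k) z, differentiableOn_ball_tsum (fun k => hd k _) hr
    (fun k => hs k _), fun k z hz => ?_⟩
  have hsmall : ∀ j, ‖h (j + (k + 1)) (G (j + (k + 1))) z‖ ≤ (1 / 2) ^ j := fun j =>
    (hs _ _ z ((hL k z hz).trans (hrm (by omega)))).trans
      (pow_le_pow_of_le_one (by norm_num) (by norm_num) (by omega))
  have hsum : Summable fun j => h (j + (k + 1)) (G (j + (k + 1))) z :=
    Summable.of_norm_bounded summable_geometric_two hsmall
  have htail : ‖∑' j, h (j + (k + 1)) (G (j + (k + 1))) z‖ ≤ 2 :=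
    tsum_of_norm_bounded hasSum_geometric_two hsmall
  have hsplit : ∑' j, h j (G j) z = ((G k).1 z + h k (G k) z) +
      ∑' j, h (j + (k + 1)) (G (j + (k + 1))) z := by
    rw [← ((summable_nat_add_iff (f := fun j => h j (G j) z) (k + 1)).1 hsum).sum_add_tsum_nat_add
      (k + 1), Finset.sum_range_succ, hGsum]
  beta_reduce
  rw [hsplit, Complex.exp_add, ← mul_assoc, norm_mul, mul_comm]
  gcongr
  · rw [Complex.norm_exp]
    exact Real.exp_le_exp.2 ((Complex.re_le_norm _).trans htail)
  · exact hm k (G k) z hz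

end Limit

section Length

lemma sum_le_eVariationOn_Icc {X : Type*} [PseudoEMetricSpace X] {γ : ℝ → X} {s : Set ℝ}
    {t : ℕ → ℝ} (ht : Monotone t) (hs : ∀ k, Icc (t k) (t (k + 1)) ⊆ s) {ρ : ℕ → ℝ≥0∞}
    (hρ : ∀ k, ∃ u ∈ Icc (t k) (t (k + 1)), ρ k ≤ edist (γ u) (γ (t (k + 1)))) (N : ℕ) :
    ∑ k ∈ Finset.range N, ρ k ≤ eVariationOn γ s := by
  have h1 : ∑ k ∈ Finset.range N, ρ k ≤ eVariationOn γ (Icc (t 0) (t N)) := by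
    rw [← eVariationOn.sum' γ ht]
    refine Finset.sum_le_sum fun k _ => ?_
    obtain ⟨u, hu, hρu⟩ := hρ k
    exact hρu.trans (eVariationOn.edist_le γ hu (right_mem_Icc.2 (ht (Nat.le_succ k))))
  cases N with
  | zero => simp
  | succ N =>
    refine h1.trans (eVariationOn.mono γ fun x hx => ?_)
    have h2 : ∀ M, Icc (t 0) (t (M + 1)) ⊆ s := by
      intro M
      induction M with
      | zero => exact hs 0
      | succ M ih =>
        rw [← Icc_union_Icc_eq_Icc (ht (Nat.zero_le (M + 1))) (ht (Nat.le_succ (M + 1)))]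
        exact union_subset ih (hs _)
    exact h2 N hx

lemma exists_crossing_times {E : Type*} [NormedAddCommGroup E] [ProperSpace E] {γ : ℝ → E}
    (hγ : DivergentPathIn (ball 0 1) γ) {r : ℕ → ℝ} (hrm : Monotone r) (hr1 : ∀ k, r k < 1)
    (h₀ : ‖γ 0‖ ≤ r 0) :
    ∃ t : ℕ → ℝ, Monotone t ∧ (∀ k, t k ∈ Ico (0 : ℝ) 1) ∧ ∀ k, ‖γ (t k)‖ = r k := by
  have next : ∀ k, ∀ a : ℝ, a ∈ Ico (0 : ℝ) 1 → ‖γ a‖ ≤ r k →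
      ∃ b ∈ Ico (0 : ℝ) 1, a ≤ b ∧ ‖γ b‖ = r k := by
    intro k a ha hak
    obtain ⟨t₀, ht₀, hesc⟩ := hγ.2.2 (closedBall 0 (r k)) (closedBall_subset_ball (hr1 k))
      (isCompact_closedBall _ _)
    have hmax : max a t₀ ∈ Ico (0 : ℝ) 1 := ⟨le_max_of_le_left ha.1, max_lt ha.2 ht₀.2⟩
    have h1 := hesc (max a t₀) ⟨le_max_right _ _, hmax.2⟩
    rw [mem_closedBall_zero_iff, not_le] at h1
    have hsub : Icc a (max a t₀) ⊆ Ico (0 : ℝ) 1 := fun x hx =>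
      ⟨ha.1.trans hx.1, hx.2.trans_lt hmax.2⟩
    obtain ⟨b, hb, hbk⟩ := intermediate_value_Icc (le_max_left a t₀)
      ((hγ.1.mono hsub).norm) ⟨hak, h1.le⟩
    exact ⟨b, hsub hb, hb.1, hbk⟩
  choose! f hf1 hf2 hf3 using next
  let t : ℕ → ℝ := fun k => Nat.rec (f 0 0) (fun k a => f (k + 1) a) k
  have ht : ∀ k, t k ∈ Ico (0 : ℝ) 1 ∧ ‖γ (t k)‖ = r k := by
    intro k
    induction k with
    | zero => exact ⟨hf1 0 0 (by simp) h₀, hf3 0 0 (by simp) h₀⟩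
    | succ k ih =>
      have h1 : ‖γ (t k)‖ ≤ r (k + 1) := ih.2.trans_le (hrm (Nat.le_succ k))
      exact ⟨hf1 _ _ ih.1 h1, hf3 _ _ ih.1 h1⟩
  exact ⟨t, monotone_nat_of_le_succ fun k => hf2 _ _ (ht k).1
    ((ht k).2.trans_le (hrm (Nat.le_succ k))), fun k => (ht k).1, fun k => (ht k).2⟩

end Length

lemma tsum_ofReal_div_add_eq_top {c : ℝ} (hc : 0 < c) (K : ℕ) :
    ∑' k : ℕ, ENNReal.ofReal (1 / (c * ((k + K : ℕ) + 3))) = ⊤ := by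
  by_contra h
  have h1 := ENNReal.summable_toReal h
  have h2 : Summable fun k : ℕ => 1 / (c * ((k + K : ℕ) + 3) : ℝ) := by
    refine h1.congr fun k => ?_
    rw [ENNReal.toReal_ofReal (by positivity)]
  have h3 : Summable fun k : ℕ => (1 / ((k + (K + 3) : ℕ) : ℝ)) := by
    refine (h2.mul_left c).congr fun k => ?_
    push_cast
    field_simp
    ring
  exact Real.not_summable_one_div_natCast ((summable_nat_add_iff (K + 3)).1 h3)

/-- Alarcón: every closed complex hypersurface in 𝔹ₙ (`n ≥ 2`), given as the zero set of a
holomorphic function `g` that is not identically zero, is the zero set of a holomorphic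
function `f` which is noncritical wherever `g` is, and all of whose other level sets are
complete. -/
theorem alarcon_hypersurface_complete_level_sets (n : ℕ) (hn : 2 ≤ n)
    (g : EuclideanSpace ℂ (Fin n) → ℂ)
    (hgdiff : DifferentiableOn ℂ g (Metric.ball (0 : EuclideanSpace ℂ (Fin n)) 1))
    (hgne : ∃ z ∈ Metric.ball (0 : EuclideanSpace ℂ (Fin n)) 1, g z ≠ 0) :
    ∃ f : EuclideanSpace ℂ (Fin n) → ℂ,
      DifferentiableOn ℂ f (Metric.ball (0 : EuclideanSpace ℂ (Fin n)) 1) ∧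
      {z ∈ Metric.ball (0 : EuclideanSpace ℂ (Fin n)) 1 | f z = 0} =
        {z ∈ Metric.ball (0 : EuclideanSpace ℂ (Fin n)) 1 | g z = 0} ∧
      (∀ z ∈ Metric.ball (0 : EuclideanSpace ℂ (Fin n)) 1,
        g z = 0 → fderiv ℂ g z ≠ 0 → fderiv ℂ f z ≠ 0) ∧
      (∀ c : ℂ, c ≠ 0 →
        ∀ γ : ℝ → EuclideanSpace ℂ (Fin n),
          DivergentPathIn (Metric.ball (0 : EuclideanSpace ℂ (Fin n)) 1) γ →
          (∀ t ∈ Set.Ico (0 : ℝ) 1, f (γ t) = c) →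
          eVariationOn γ (Set.Ico 0 1) = ⊤) := by
  obtain ⟨Q, hQ, hlab⟩ := exists_labyrinth n
  have hQ0 : 0 < Q := by linarith
  set r : ℕ → ℝ := fun k => 1 - 1 / ((k : ℝ) + 2) with hr
  set ρ : ℕ → ℝ := fun k => 1 / (Q * ((k : ℝ) + 3)) with hρ
  have hr1 : ∀ k, r k < 1 := fun k => by
    have : 0 < 1 / ((k : ℝ) + 2) := by positivity
    simp only [hr]; linarith
  have hρ0 : ∀ k, 0 < ρ k := fun k => by positivity
  have hrhalf : ∀ k, 1 / 2 ≤ r k := fun k => by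
    have : 1 / ((k : ℝ) + 2) ≤ 1 / 2 := by gcongr; linarith [show (0 : ℝ) ≤ k by positivity]
    simp only [hr]; linarith
  have hstep : ∀ k, r k + Q * ρ k ^ 2 ≤ r (k + 1) := fun k => by
    have h1 : Q * ρ k ^ 2 ≤ 1 / (((k : ℝ) + 2) * (k + 3)) := by
      have : Q * ρ k ^ 2 = 1 / (Q * ((k : ℝ) + 3) * (k + 3)) := by
        simp only [hρ]; field_simp
      rw [this]
      gcongr
      nlinarith [show (0 : ℝ) ≤ k by positivity]
    have h2 : r (k + 1) = r k + 1 / (((k : ℝ) + 2) * (k + 3)) := by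
      simp only [hr]; push_cast; field_simp; ring
    linarith
  have hrm : Monotone r := monotone_nat_of_le_succ fun k => by
    have := hstep k
    have : 0 ≤ Q * ρ k ^ 2 := by positivity
    linarith
  have hrt : Filter.Tendsto r Filter.atTop (nhds 1) := by
    have h1 : Filter.Tendsto (fun k : ℕ => (k : ℝ) + 2) Filter.atTop Filter.atTop :=
      Filter.tendsto_atTop_add_const_right _ _ tendsto_natCast_atTop_atTop
    have h2 := (tendsto_const_nhds (x := (1 : ℝ))).sub (h1.inv_tendsto_atTop)
    simpa [hr] using h2
  choose L hL hpush hcross using fun k =>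
    hlab (ρ k) (r k) (r (k + 1)) (hρ0 k) (hrhalf k) (hstep k) (hr1 (k + 1)).le
  obtain ⟨H, hH, hHL⟩ := exists_exp_factor hgdiff.continuousOn hrt hrm hr1 hL hpush
  refine ⟨fun z => g z * Complex.exp (H z), hgdiff.mul hH.cexp, ?_, ?_, ?_⟩
  · ext z
    simp [Complex.exp_ne_zero]
  · intro z hz hgz hDg hDf
    have hz' := isOpen_ball.mem_nhds hz
    have h1 := (hgdiff.differentiableAt hz').hasFDerivAt.mul
      ((hH.differentiableAt hz').cexp).hasFDerivAt
    have h2 : Complex.exp (H z) • fderiv ℂ g z = 0 := by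
      have h3 := h1.fderiv.symm.trans hDf
      ext v
      simpa [hgz] using DFunLike.congr_fun h3 v
    exact hDg ((smul_eq_zero.1 h2).resolve_left (Complex.exp_ne_zero _))
  · intro c hc γ hγ hlevel
    have hlim : Filter.Tendsto (fun k : ℕ => Real.exp 2 * (1 / 2 : ℝ) ^ k) Filter.atTop
        (nhds 0) := by
      simpa using (tendsto_pow_atTop_nhds_zero_of_lt_one (r := (1 / 2 : ℝ)) (by norm_num)
        (by norm_num)).const_mul (Real.exp 2)
    have hγ0 : ‖γ 0‖ < 1 := by simpa using hγ.2.1 0 (by simp)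
    obtain ⟨K, hK⟩ := Filter.eventually_atTop.1
      ((hlim.eventually (gt_mem_nhds (norm_pos_iff.2 hc))).and
        (hrt.eventually (lt_mem_nhds hγ0)))
    have havoid : ∀ k, ∀ t ∈ Ico (0 : ℝ) 1, γ t ∉ L (k + K) := by
      intro k t ht htL
      have h1 := hHL _ _ htL
      have h2 := hlevel t ht
      simp only at h2
      rw [h2] at h1
      exact absurd h1 (not_le.2 (hK (k + K) (by omega)).1)
    obtain ⟨t, htm, ht, htr⟩ := exists_crossing_times hγ (r := fun k => r (k + K))
      (fun i j hij => hrm (by omega)) (fun k => hr1 _) ((hK (0 + K) (by omega)).2.le)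
    have hsub : ∀ k, Icc (t k) (t (k + 1)) ⊆ Ico (0 : ℝ) 1 := fun k x hx =>
      ⟨(ht k).1.trans hx.1, hx.2.trans_lt (ht (k + 1)).2⟩
    have hbound := sum_le_eVariationOn_Icc (γ := γ) htm hsub
      (ρ := fun k => ENNReal.ofReal (ρ (k + K))) (fun k => by
        obtain ⟨u, hu, huρ⟩ := hcross (k + K) γ (t k) (t (k + 1)) (htm (Nat.le_succ k))
          (hγ.1.mono (hsub k)) (htr k).le (by rw [htr (k + 1)]; exact hrm (by omega))
          (by rw [htr (k + 1)]; exact (hr1 _).le) (fun u hu => havoid k u (hsub k hu))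
        refine ⟨u, hu, ?_⟩
        rw [edist_dist, dist_eq_norm]
        exact ENNReal.ofReal_le_ofReal huρ)
    rw [eq_top_iff, ← tsum_ofReal_div_add_eq_top hQ0 K, ENNReal.tsum_eq_iSup_nat]
    exact iSup_le hbound
end
end

section
/- Let n ≥ 2 and let D ⊆ ℂⁿ be a nonempty open convex set. Then there exists a holomorphic function f : D → ℂ such that for every divergent path γ : [0,1) → D of finite length, the image f(γ([0,1))) is dense in ℂ. (Charpentier–Kosiński: holomorphic functions with wild boundary behavior along all divergent paths of finite length; convex domains are pseudoconvex.) -/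
open Set Metric
open scoped ENNReal

noncomputable section

open Polynomial

theorem isUnit_aeval_of_forall_spectrum {A : Type*} [Ring A] [Algebra ℂ A] (a : A) {p : ℂ[X]}
    (hp : p ≠ 0) (h : ∀ z ∈ spectrum ℂ a, p.eval z ≠ 0) : IsUnit (aeval a p) := by
  rw [(IsAlgClosed.splits p).eq_prod_roots, map_mul, aeval_C]
  refine IsUnit.mul ((isUnit_iff_ne_zero.2 (leadingCoeff_ne_zero.2 hp)).map _) ?_
  by_contra hn
  obtain ⟨k, hk, hk0⟩ := spectrum.exists_mem_of_not_isUnit_aeval_prod hn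
  exact h k hk hk0

theorem Subalgebra.inter_spectrum_eq_empty {A : Type*} [NormedRing A] [NormedAlgebra ℂ A]
    [CompleteSpace A] (S : Subalgebra ℂ A) (hS : IsClosed (S : Set A)) (x : S) {L : Set ℂ}
    (hL : IsPreconnected L) (hLu : ¬ Bornology.IsBounded L)
    (hd : ∀ z ∈ L, z ∉ spectrum ℂ (x : A)) : ∀ z ∈ L, z ∉ spectrum ℂ x := by
  have : IsClosed (S : Set A) := hS
  have : CompleteSpace S := hS.completeSpace_coe
  by_contra! hcon
  obtain ⟨z, hzL, hz⟩ := hcon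
  have hfr : L ∩ frontier (spectrum ℂ x) = ∅ := by
    rw [eq_empty_iff_forall_notMem]
    rintro w ⟨hw, hw'⟩
    exact hd w hw (Subalgebra.frontier_spectrum S x hw')
  have hsub : L ⊆ interior (spectrum ℂ x) := by
    refine hL.subset_of_closure_inter_subset isOpen_interior ⟨z, hzL, ?_⟩ ?_
    · by_contra hzi
      exact eq_empty_iff_forall_notMem.1 hfr z ⟨hzL, subset_closure hz, hzi⟩
    · rintro w ⟨hw, hwL⟩
      by_contra hwi
      exact eq_empty_iff_forall_notMem.1 hfr w
        ⟨hwL, closure_mono interior_subset hw, hwi⟩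
  exact hLu ((spectrum.isBounded x).subset (hsub.trans interior_subset))

theorem exists_norm_sub_one_le_mul_norm_add_one {K : Set ℂ} (hK : IsCompact K)
    (h : ∀ z ∈ K, 0 < z.re) : ∃ κ : ℝ, 0 ≤ κ ∧ κ < 1 ∧ ∀ z ∈ K, ‖z - 1‖ ≤ κ * ‖z + 1‖ := by
  rcases K.eq_empty_or_nonempty with rfl | hne
  · exact ⟨0, le_rfl, one_pos, by simp⟩
  have hpos : ∀ z ∈ K, 0 < ‖z + 1‖ := by
    intro z hz
    rw [norm_pos_iff]
    intro h0
    have := congrArg Complex.re h0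
    simp at this
    linarith [h z hz]
  have hcont : ContinuousOn (fun z : ℂ => ‖z - 1‖ / ‖z + 1‖) K :=
    ContinuousOn.div (by fun_prop) (by fun_prop) fun z hz => (hpos z hz).ne'
  obtain ⟨w, hw, hmax⟩ := hK.exists_isMaxOn hne hcont
  refine ⟨‖w - 1‖ / ‖w + 1‖, by positivity, ?_, fun z hz => ?_⟩
  · rw [div_lt_one (hpos w hw), ← sq_lt_sq₀ (norm_nonneg _) (norm_nonneg _),
      ← Complex.normSq_eq_norm_sq, ← Complex.normSq_eq_norm_sq, Complex.normSq_apply,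
      Complex.normSq_apply]
    simp
    nlinarith [h w hw]
  · exact (div_le_iff₀ (hpos z hz)).1 (hmax hz)

theorem norm_sub_one_le_of_mul_sub_eq {a b u : ℂ} {c : ℝ} (hc : c ≤ 1 / 2) (ha : a ≠ 0)
    (hb : ‖b‖ ≤ c * ‖a‖) (h : u * (a - b) = a) : ‖u - 1‖ ≤ 2 * c := by
  have h1 : (u - 1) * (a - b) = b := by linear_combination h
  have h2 : ‖a‖ - ‖b‖ ≤ ‖a - b‖ := norm_sub_norm_le a b
  have hapos : 0 < ‖a‖ := norm_pos_iff.2 ha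
  have h3 : ‖u - 1‖ * ‖a - b‖ = ‖b‖ := by rw [← norm_mul, h1]
  have h4 : ‖u - 1‖ * (‖a‖ / 2) ≤ c * ‖a‖ := by
    refine le_trans ?_ (h3.le.trans hb)
    gcongr
    nlinarith
  have : (‖u - 1‖ / 2 - c) * ‖a‖ ≤ 0 := by linarith
  have := nonpos_of_mul_nonpos_left this hapos
  linarith

/-- Two compact sets separated by the imaginary axis: some polynomial is close to `0` on the left
one and close to `1` on the right one. -/
theorem exists_polynomial_near_zero_one {K₁ K₂ : Set ℂ} (h₁ : IsCompact K₁) (h₂ : IsCompact K₂)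
    (hneg : ∀ z ∈ K₁, z.re < 0) (hpos : ∀ z ∈ K₂, 0 < z.re) {ε : ℝ} (hε : 0 < ε) :
    ∃ p : ℂ[X], (∀ z ∈ K₁, ‖p.eval z‖ < ε) ∧ ∀ z ∈ K₂, ‖p.eval z - 1‖ < ε := by
  obtain ⟨κ₁, hκ₁0, hκ₁1, hκ₁⟩ := exists_norm_sub_one_le_mul_norm_add_one h₁.neg
    (fun z hz => by simpa using hneg _ hz)
  obtain ⟨κ₂, hκ₂0, hκ₂1, hκ₂⟩ := exists_norm_sub_one_le_mul_norm_add_one h₂ hpos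
  obtain ⟨m, hm⟩ : ∃ m : ℕ, max κ₁ κ₂ ^ m < min (1 / 2) (ε / 4) :=
    exists_pow_lt_of_lt_one (by positivity) (max_lt hκ₁1 hκ₂1)
  have hm2 : max κ₁ κ₂ ^ m ≤ 1 / 2 := hm.le.trans (min_le_left _ _)
  have hm4 : max κ₁ κ₂ ^ m < ε / 4 := hm.trans_le (min_le_right _ _)
  have hm0 : m ≠ 0 := by
    rintro rfl
    norm_num at hm2
  have : CompactSpace ↥(K₁ ∪ K₂) := isCompact_iff_compactSpace.1 (h₁.union h₂)
  let x : C(↥(K₁ ∪ K₂), ℂ) := ⟨Subtype.val, continuous_subtype_val⟩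
  let S := Algebra.elemental ℂ x
  have hScl : IsClosed (S : Set C(↥(K₁ ∪ K₂), ℂ)) := Algebra.elemental.isClosed ℂ x
  let y : S := ⟨x, Algebra.elemental.self_mem ℂ x⟩
  have hspec : ∀ z ∈ {z : ℂ | z.re = 0}, z ∉ spectrum ℂ y := by
    refine Subalgebra.inter_spectrum_eq_empty S hScl y ?_ ?_ ?_
    · refine Convex.isPreconnected ?_
      exact convex_hyperplane Complex.reLm.isLinear 0
    · intro hb
      obtain ⟨R, hR⟩ := hb.exists_norm_le
      have := hR (((|R| + 1 : ℝ) : ℂ) * Complex.I) (by simp)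
      simp only [norm_mul, Complex.norm_I, mul_one, Complex.norm_real, Real.norm_eq_abs] at this
      rw [abs_of_nonneg (by positivity)] at this
      linarith [le_abs_self R]
    · intro z hz hmem
      have hmem' : z ∈ spectrum ℂ x := hmem
      rw [ContinuousMap.spectrum_eq_range] at hmem'
      obtain ⟨⟨w, hw⟩, rfl⟩ := hmem'
      have hz' : w.re = 0 := hz
      rcases hw with hw | hw
      · exact (hneg w hw).ne hz'
      · exact (hpos w hw).ne' hz'
  let P : ℂ[X] := (X + 1) ^ m
  let Q : ℂ[X] := (X - 1) ^ m
  have hunit : IsUnit (aeval y (P - Q)) := by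
    refine isUnit_aeval_of_forall_spectrum y ?_ fun z hz h0 => ?_
    · intro h0
      have := congrArg (Polynomial.eval 1) h0
      simp [P, Q, hm0] at this
    · refine hspec z ?_ hz
      have h1 : (z + 1) ^ m = (z - 1) ^ m := by
        simpa [P, Q, sub_eq_zero] using h0
      have h2 : ‖z + 1‖ = ‖z - 1‖ := by
        have := congrArg norm h1
        rw [norm_pow, norm_pow] at this
        exact (pow_left_inj₀ (norm_nonneg _) (norm_nonneg _) hm0).1 this
      have h3 : Complex.normSq (z + 1) = Complex.normSq (z - 1) := by
        rw [Complex.normSq_eq_norm_sq, Complex.normSq_eq_norm_sq, h2]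
      simp only [Complex.normSq_apply, Complex.add_re, Complex.sub_re, Complex.one_re,
        Complex.add_im, Complex.sub_im, Complex.one_im] at h3
      change z.re = 0
      linarith
  obtain ⟨v, hv⟩ := hunit.exists_left_inv
  let u : S := v * aeval y P
  have hu : u * aeval y (P - Q) = aeval y P := by
    simp only [u]
    rw [mul_assoc, mul_comm (aeval y P), ← mul_assoc, hv, one_mul]
  have hueval : ∀ z (hz : z ∈ K₁ ∪ K₂),
      (u : C(↥(K₁ ∪ K₂), ℂ)) ⟨z, hz⟩ * ((z + 1) ^ m - (z - 1) ^ m) = (z + 1) ^ m := by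
    intro z hz
    have := congrArg (fun s : S => (s : C(↥(K₁ ∪ K₂), ℂ)) ⟨z, hz⟩) hu
    simpa [P, Q, y, x] using this
  have hu1 : ∀ z (hz : z ∈ K₁ ∪ K₂), z ∈ K₁ →
      ‖(u : C(↥(K₁ ∪ K₂), ℂ)) ⟨z, hz⟩‖ < ε / 2 := by
    intro z hz hz1
    have hk := hκ₁ (-z) (by simpa using hz1)
    rw [← norm_neg, ← norm_neg (-z + 1)] at hk
    have hne : (z - 1) ^ m ≠ 0 := by
      refine pow_ne_zero _ fun h0 => ?_
      have := congrArg Complex.re h0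
      simp at this
      linarith [hneg z hz1]
    have := norm_sub_one_le_of_mul_sub_eq (a := (z - 1) ^ m) (b := (z + 1) ^ m)
      (u := 1 - (u : C(↥(K₁ ∪ K₂), ℂ)) ⟨z, hz⟩) hm2 hne ?_ ?_
    · rw [sub_sub_cancel_left, norm_neg] at this
      linarith
    · rw [norm_pow, norm_pow, ← mul_pow]
      refine pow_le_pow_left₀ (norm_nonneg _) ?_ m
      calc ‖z + 1‖ = ‖-(-z - 1)‖ := by congr 1; ring
        _ ≤ κ₁ * ‖-(-z + 1)‖ := hk
        _ = κ₁ * ‖z - 1‖ := by congr 2; ring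
        _ ≤ _ := by gcongr; exact le_max_left _ _
    · linear_combination hueval z hz
  have hu2 : ∀ z (hz : z ∈ K₁ ∪ K₂), z ∈ K₂ →
      ‖(u : C(↥(K₁ ∪ K₂), ℂ)) ⟨z, hz⟩ - 1‖ < ε / 2 := by
    intro z hz hz2
    have hne : (z + 1) ^ m ≠ 0 := by
      refine pow_ne_zero _ fun h0 => ?_
      have := congrArg Complex.re h0
      simp at this
      linarith [hpos z hz2]
    have := norm_sub_one_le_of_mul_sub_eq (b := (z - 1) ^ m) hm2 hne ?_ (hueval z hz)
    · linarith
    · rw [norm_pow, norm_pow, ← mul_pow]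
      refine pow_le_pow_left₀ (norm_nonneg _) ((hκ₂ z hz2).trans ?_) m
      gcongr
      exact le_max_right _ _
  have hcl : (u : C(↥(K₁ ∪ K₂), ℂ)) ∈ closure (Algebra.adjoin ℂ {x} : Set C(↥(K₁ ∪ K₂), ℂ)) :=
    u.2
  obtain ⟨w, hw, hwu⟩ := Metric.mem_closure_iff.1 hcl (ε / 2) (by positivity)
  rw [SetLike.mem_coe, Algebra.adjoin_singleton_eq_range_aeval] at hw
  obtain ⟨p, rfl⟩ := hw
  have hpe : ∀ z (hz : z ∈ K₁ ∪ K₂),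
      ‖p.eval z - (u : C(↥(K₁ ∪ K₂), ℂ)) ⟨z, hz⟩‖ < ε / 2 := by
    intro z hz
    have h1 := (ContinuousMap.dist_apply_le_dist (⟨z, hz⟩ : ↥(K₁ ∪ K₂))).trans_lt hwu
    rw [dist_comm, dist_eq_norm] at h1
    simpa [x] using h1
  refine ⟨p, fun z hz => ?_, fun z hz => ?_⟩
  · have h1 := hpe z (Or.inl hz)
    have h2 := hu1 z (Or.inl hz) hz
    have := norm_add_le (p.eval z - (u : C(↥(K₁ ∪ K₂), ℂ)) ⟨z, Or.inl hz⟩)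
      ((u : C(↥(K₁ ∪ K₂), ℂ)) ⟨z, Or.inl hz⟩)
    rw [sub_add_cancel] at this
    linarith
  · have h1 := hpe z (Or.inr hz)
    have h2 := hu2 z (Or.inr hz) hz
    have := norm_add_le (p.eval z - (u : C(↥(K₁ ∪ K₂), ℂ)) ⟨z, Or.inr hz⟩)
      ((u : C(↥(K₁ ∪ K₂), ℂ)) ⟨z, Or.inr hz⟩ - 1)
    rw [sub_add_sub_cancel] at this
    linarith

section Gluing

variable {E : Type*} [NormedAddCommGroup E] [NormedSpace ℂ E]

/-- Every entire function on `A` and every constant on `W` admit a simultaneous uniform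
approximation by an entire function. -/
def EntireGlue (A W : Set E) : Prop :=
  ∀ g : E → ℂ, Differentiable ℂ g → ∀ (q : ℂ) (ε : ℝ), 0 < ε →
    ∃ h : E → ℂ, Differentiable ℂ h ∧ (∀ x ∈ A, ‖h x - g x‖ < ε) ∧ ∀ x ∈ W, ‖h x - q‖ < ε

theorem EntireGlue.empty (A : Set E) : EntireGlue A ∅ := fun g hg _ _ hε =>
  ⟨g, hg, fun x _ => by simpa using hε, by simp⟩

theorem EntireGlue.mono {A A' W : Set E} (h : EntireGlue A W) (hA : A' ⊆ A) :
    EntireGlue A' W := fun g hg q ε hε => by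
  obtain ⟨k, hk, hkA, hkW⟩ := h g hg q ε hε
  exact ⟨k, hk, fun x hx => hkA x (hA hx), hkW⟩

theorem EntireGlue.union {A A' W W' : Set E} (h : EntireGlue A W) (h' : EntireGlue A' W')
    (hA : A ⊆ A') (hW : W ⊆ A') : EntireGlue A (W ∪ W') := fun g hg q ε hε => by
  obtain ⟨k, hk, hkA, hkW⟩ := h g hg q (ε / 2) (by positivity)
  obtain ⟨l, hl, hlA, hlW⟩ := h' k hk q (ε / 2) (by positivity)
  refine ⟨l, hl, fun x hx => ?_, ?_⟩
  · have := norm_sub_le_norm_sub_add_norm_sub (l x) (k x) (g x)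
    linarith [hlA x (hA hx), hkA x hx]
  · rintro x (hx | hx)
    · have := norm_sub_le_norm_sub_add_norm_sub (l x) (k x) q
      linarith [hlA x (hW hx), hkW x hx]
    · linarith [hlW x hx]

theorem EntireGlue.of_hyperplane {A W : Set E} (hA : IsCompact A) (hW : IsCompact W)
    (l : E →L[ℂ] ℂ) (b : ℝ) (hlA : ∀ x ∈ A, (l x).re < b) (hlW : ∀ x ∈ W, (l x).re = b) :
    EntireGlue A W := by
  intro g hg q ε hε
  obtain ⟨τ, hτb, hτ⟩ : ∃ τ < b, ∀ x ∈ A, (l x).re < τ := by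
    rcases A.eq_empty_or_nonempty with rfl | hne
    · exact ⟨b - 1, by linarith, by simp⟩
    · have hcont : Continuous fun x => (l x).re := Complex.continuous_re.comp l.continuous
      obtain ⟨w, hw, hmax⟩ := hA.exists_isMaxOn hne hcont.continuousOn
      refine ⟨((l w).re + b) / 2, by linarith [hlA w hw], fun x hx => ?_⟩
      have : (l x).re ≤ (l w).re := hmax hx
      linarith [hlA w hw]
  obtain ⟨M, hM⟩ := (hA.union hW).exists_bound_of_continuousOn
    (f := fun x => q - g x) (by have := hg.continuous; fun_prop)
  have hcl : Continuous fun x => l x - (τ : ℂ) := by fun_prop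
  obtain ⟨p, hp1, hp2⟩ := exists_polynomial_near_zero_one (hA.image hcl) (hW.image hcl)
    (by rintro _ ⟨x, hx, rfl⟩; simpa using hτ x hx)
    (by rintro _ ⟨x, hx, rfl⟩; simpa [hlW x hx] using hτb)
    (ε := ε / (|M| + 1)) (by positivity)
  have key : ∀ x ∈ A ∪ W, ∀ c : ℂ, ‖c‖ < ε / (|M| + 1) → ‖(q - g x) * c‖ < ε := by
    intro x hx c hc
    rw [lt_div_iff₀ (by positivity)] at hc
    have h1 := (hM x hx).trans (le_abs_self M)
    rw [norm_mul]
    nlinarith [norm_nonneg c, norm_nonneg (q - g x)]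
  refine ⟨fun x => g x + (q - g x) * p.eval (l x - τ), ?_, fun x hx => ?_, fun x hx => ?_⟩
  · have hp : Differentiable ℂ fun x => p.eval (l x - (τ : ℂ)) :=
      p.differentiable.comp (l.differentiable.sub_const _)
    exact hg.add (((differentiable_const q).sub hg).mul hp)
  · rw [add_sub_cancel_left]
    exact key x (Or.inl hx) _ (hp1 _ (mem_image_of_mem _ hx))
  · have := key x (Or.inr hx) _ (hp2 _ (mem_image_of_mem _ hx))
    convert this using 2
    ring

theorem EntireGlue.biUnion {ι : Type*} {A : Set E} (hA : IsCompact A) {S : Set ι} (hS : S.Finite)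
    (T : ι → Set E) (hT : ∀ a ∈ S, IsCompact (T a)) (l : ι → E →L[ℂ] ℂ) (b : ι → ℝ)
    (hlA : ∀ a ∈ S, ∀ x ∈ A, (l a x).re < b a) (hlT : ∀ a ∈ S, ∀ x ∈ T a, (l a x).re = b a)
    (hlT' : ∀ a ∈ S, ∀ a' ∈ S, a ≠ a' → ∀ x ∈ T a', (l a x).re < b a) :
    EntireGlue A (⋃ a ∈ S, T a) := by
  induction S, hS using Set.Finite.induction_on with
  | empty => simpa using EntireGlue.empty A
  | @insert a S ha hS ih =>
    rw [biUnion_insert, union_comm]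
    have hmem : ∀ {a'}, a' ∈ S → a' ∈ insert a S := fun h => mem_insert_of_mem _ h
    have h1 := ih (fun c hc => hT c (hmem hc)) (fun c hc => hlA c (hmem hc))
      (fun c hc => hlT c (hmem hc)) (fun c hc c' hc' => hlT' c (hmem hc) c' (hmem hc'))
    refine h1.union (EntireGlue.of_hyperplane
      (hA.union (hS.isCompact_biUnion fun c hc => hT c (hmem hc))) (hT a (mem_insert _ _))
      (l a) (b a) ?_ (hlT a (mem_insert _ _))) subset_union_left subset_union_right
    rintro x (hx | hx)
    · exact hlA a (mem_insert _ _) x hx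
    · obtain ⟨c, hc, hxc⟩ := mem_iUnion₂.1 hx
      exact hlT' a (mem_insert _ _) c (hmem hc) (fun h => ha (h ▸ hc)) x hxc

theorem norm_fderiv_le_of_forall_ball {h : E → ℂ} (hh : Differentiable ℂ h) {y : E} {r C : ℝ}
    (hr : 0 < r) (hC : ∀ x ∈ closedBall y r, ‖h x‖ ≤ C) : ‖fderiv ℂ h y‖ ≤ C / r := by
  have hC0 : 0 ≤ C := (norm_nonneg _).trans (hC y (mem_closedBall_self hr.le))
  refine ContinuousLinearMap.opNorm_le_bound _ (by positivity) fun v => ?_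
  rcases eq_or_ne v 0 with rfl | hv
  · simp
  have hv0 : 0 < ‖v‖ := norm_pos_iff.2 hv
  have hd : HasDerivAt (fun t : ℂ => h (y + t • v)) (fderiv ℂ h y v) 0 := by
    have h1 : HasDerivAt (fun t : ℂ => y + t • v) v 0 := by
      simpa using ((hasDerivAt_id (0 : ℂ)).smul_const v).const_add y
    have h2 : HasFDerivAt h (fderiv ℂ h y) (y + (0 : ℂ) • v) := by
      simpa using (hh y).hasFDerivAt
    exact h2.comp_hasDerivAt 0 h1
  have hdiff : Differentiable ℂ fun t : ℂ => h (y + t • v) := by fun_prop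
  have := Complex.norm_deriv_le_of_forall_mem_sphere_norm_le (c := 0) (R := r / ‖v‖) (C := C)
    (by positivity) hdiff.diffContOnCl fun z hz => hC _ (by
      rw [mem_sphere_zero_iff_norm] at hz
      rw [mem_closedBall, dist_eq_norm, add_sub_cancel_left, norm_smul, hz,
        div_mul_cancel₀ _ hv0.ne'])
  rw [hd.deriv] at this
  calc _ ≤ _ := this
    _ = _ := by field_simp

theorem exists_differentiableOn_limit {D : Set E} {K : ℕ → Set E} (hmono : Monotone K)
    (hcover : ∀ x ∈ D, ∃ k, K k ∈ nhds x) {f : ℕ → E → ℂ} (hf : ∀ k, Differentiable ℂ (f k))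
    (hfK : ∀ k, ∀ x ∈ K k, ‖f (k + 1) x - f k x‖ ≤ (1 / 2) ^ k) :
    ∃ F : E → ℂ, DifferentiableOn ℂ F D ∧
      ∀ k, ∀ x ∈ K k, ‖F x - f k x‖ ≤ 2 * (1 / 2) ^ k := by
  let g : ℕ → E → ℂ := fun k x => f (k + 1) x - f k x
  have hg : ∀ k, Differentiable ℂ (g k) := fun k => (hf _).sub (hf _)
  have hgeom : ∀ k, HasSum (fun j : ℕ => (1 / 2 : ℝ) ^ (j + k)) (2 * (1 / 2) ^ k) := by
    intro k
    simpa [pow_add] using hasSum_geometric_two.mul_right ((1 / 2 : ℝ) ^ k)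
  have hgb : ∀ k, ∀ x ∈ K k, ∀ j, ‖g (j + k) x‖ ≤ (1 / 2) ^ (j + k) := fun k x hx j =>
    hfK (j + k) x (hmono (Nat.le_add_left k j) hx)
  have hsum' : ∀ k, ∀ x ∈ K k, Summable fun j => g (j + k) x := fun k x hx =>
    (hgeom k).summable.of_norm_bounded (hgb k x hx)
  have hsum : ∀ k, ∀ x ∈ K k, Summable fun j => g j x := fun k x hx =>
    (summable_nat_add_iff k).1 (hsum' k x hx)
  have htail : ∀ k, ∀ x ∈ K k, f 0 x + ∑' j, g j x = f k x + ∑' j, g (j + k) x := by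
    intro k x hx
    rw [← (hsum k x hx).sum_add_tsum_nat_add k, Finset.sum_range_sub (fun i => f i x)]
    ring
  refine ⟨fun x => f 0 x + ∑' j, g j x, fun x hx => ?_, fun k x hx => ?_⟩
  · obtain ⟨k, hk⟩ := hcover x hx
    obtain ⟨r, hr, hrK⟩ := Metric.mem_nhds_iff.1 hk
    have hr3 : 0 < r / 3 := by positivity
    have hsub : ∀ y ∈ ball x (r / 3), closedBall y (r / 3) ⊆ K k := by
      intro y hy z hz
      apply hrK
      rw [mem_ball] at hy ⊢
      rw [mem_closedBall] at hz
      linarith [dist_triangle z y x]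
    have hfd := hasFDerivAt_tsum_of_isPreconnected (𝕜 := ℂ)
      (f := fun j y => g (j + k) y) (f' := fun j y => fderiv ℂ (g (j + k)) y)
      (u := fun j : ℕ => (1 / 2 : ℝ) ^ (j + k) / (r / 3)) (s := ball x (r / 3)) (x₀ := x) (x := x)
      ((hgeom k).summable.div_const _) isOpen_ball ?_
      (fun j y _ => (hg _ y).hasFDerivAt)
      (fun j y hy => norm_fderiv_le_of_forall_ball (hg _) hr3
        fun z hz => hgb k z (hsub y hy hz) j)
      (mem_ball_self hr3) (hsum' k x (mem_of_mem_nhds hk)) (mem_ball_self hr3)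
    · refine DifferentiableAt.differentiableWithinAt ?_
      refine ((hf k x).add hfd.differentiableAt).congr_of_eventuallyEq ?_
      filter_upwards [hk] with y hy
      exact htail k y hy
    · let : NormedSpace ℝ E := NormedSpace.complexToReal
      exact (convex_ball x (r / 3)).isPreconnected
  · simp only
    rw [htail k x hx, add_sub_cancel_left]
    exact tsum_of_norm_bounded (hgeom k) (hgb k x hx)

end Gluing

section Labyrinth

variable {E : Type*} [NormedAddCommGroup E] [InnerProductSpace ℂ E]

/-- The squared distance to a compact convex set lies above its tangent plane, and below the
tangent paraboloid of curvature `1`. -/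
theorem exists_gradient_infDist_sq {K : Set E} (hK : IsCompact K) (hKc : Convex ℝ K)
    (hKne : K.Nonempty) : ∃ g : E → E, ∀ a x,
      0 ≤ infDist x K ^ 2 - infDist a K ^ 2 - 2 * (inner ℂ (g a) (x - a)).re ∧
      infDist x K ^ 2 - infDist a K ^ 2 - 2 * (inner ℂ (g a) (x - a)).re ≤ ‖x - a‖ ^ 2 := by
  let : InnerProductSpace ℝ E := InnerProductSpace.complexToReal
  have hin : ∀ u v : E, (inner ℂ u v).re = inner ℝ u v := fun u v => rfl
  simp only [hin]
  have hproj : ∀ a, ∃ p ∈ K, infDist a K = ‖a - p‖ ∧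
      ∀ w ∈ K, inner ℝ (a - p) (w - p) ≤ 0 := by
    intro a
    obtain ⟨p, hp, hpa⟩ := hK.exists_infDist_eq_dist hKne a
    refine ⟨p, hp, by rw [hpa, dist_eq_norm], ?_⟩
    rw [← norm_eq_iInf_iff_real_inner_le_zero hKc hp, ← dist_eq_norm, ← hpa, infDist_eq_iInf]
    simp only [dist_eq_norm]
  choose P hPK hP hPi using hproj
  refine ⟨fun a => a - P a, fun a x => ⟨?_, ?_⟩⟩
  · rw [hP x, hP a]
    have h1 := hPi a (P x) (hPK x)
    have h2 : x - P x = (a - P a) + (x - a) - (P x - P a) := by abel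
    rw [h2]
    beta_reduce
    generalize a - P a = w at *
    generalize x - a = v at *
    generalize P x - P a = z at *
    have h3 : ‖w + v - z‖ ^ 2 = ‖w‖ ^ 2 + 2 * inner ℝ w (v - z) + ‖v - z‖ ^ 2 := by
      rw [add_sub_assoc, norm_add_sq_real]
    rw [h3, inner_sub_right]
    nlinarith [sq_nonneg ‖v - z‖]
  · have h1 : infDist x K ≤ ‖(a - P a) + (x - a)‖ := by
      rw [show (a - P a) + (x - a) = x - P a by abel, ← dist_eq_norm]
      exact infDist_le_dist_of_mem (hPK a)
    have h2 : infDist x K ^ 2 ≤ ‖(a - P a) + (x - a)‖ ^ 2 :=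
      pow_le_pow_left₀ infDist_nonneg h1 2
    rw [norm_add_sq_real] at h2
    rw [hP a]
    linarith

/-- Second-order control of a real function `ρ` with gradient `G`: its Bregman divergence is
between `m ‖x - a‖²` and `2 ‖x - a‖²`. -/
structure QuadControlled (ρ : E → ℝ) (G : E → E) (m : ℝ) : Prop where
  cont : Continuous ρ
  compact : ∀ c, IsCompact {x | ρ x ≤ c}
  pos : 0 < m
  lower : ∀ a x, m * ‖x - a‖ ^ 2 ≤ ρ x - ρ a - (inner ℂ (G a) (x - a)).re
  upper : ∀ a x, ρ x - ρ a - (inner ℂ (G a) (x - a)).re ≤ 2 * ‖x - a‖ ^ 2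

theorem quadControlled_infDist_sq_add [ProperSpace E] {K : Set E} (hK : IsCompact K)
    (hKc : Convex ℝ K) (hKne : K.Nonempty) {ε : ℝ} (hε : 0 < ε) (hε1 : ε ≤ 1) :
    ∃ G : E → E, QuadControlled (fun x => infDist x K ^ 2 + ε * ‖x‖ ^ 2) G ε := by
  obtain ⟨g, hg⟩ := exists_gradient_infDist_sq hK hKc hKne
  have hcont : Continuous fun x => infDist x K ^ 2 + ε * ‖x‖ ^ 2 := by
    have := continuous_infDist_pt K
    fun_prop
  have key : ∀ a x : E, ‖x‖ ^ 2 = ‖a‖ ^ 2 + 2 * (inner ℂ a (x - a)).re + ‖x - a‖ ^ 2 := by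
    intro a x
    have := norm_add_sq (𝕜 := ℂ) a (x - a)
    rwa [add_sub_cancel] at this
  have hin : ∀ a x : E, (inner ℂ ((2 : ℂ) • g a + ((2 * ε : ℝ) : ℂ) • a) (x - a)).re =
      2 * (inner ℂ (g a) (x - a)).re + 2 * ε * (inner ℂ a (x - a)).re := by
    intro a x
    rw [inner_add_left, inner_smul_left, inner_smul_left, Complex.conj_ofReal,
      Complex.add_re, Complex.re_ofReal_mul, Complex.conj_ofNat, ← Complex.ofReal_ofNat,
      Complex.re_ofReal_mul]
  refine ⟨fun a => (2 : ℂ) • g a + ((2 * ε : ℝ) : ℂ) • a, hcont, fun c => ?_, hε,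
    fun a x => ?_, fun a x => ?_⟩
  · refine (isCompact_closedBall (0 : E) ((|c| + 1) / ε + 1)).of_isClosed_subset
      (isClosed_le hcont continuous_const) fun x hx => ?_
    rw [mem_closedBall_zero_iff]
    have hx' : infDist x K ^ 2 + ε * ‖x‖ ^ 2 ≤ c := hx
    by_contra! hlt
    have h0 : 0 < (|c| + 1) / ε := by positivity
    have h1 : (|c| + 1) / ε < ‖x‖ ^ 2 := by nlinarith
    rw [div_lt_iff₀ hε] at h1
    nlinarith [le_abs_self c, sq_nonneg (infDist x K)]
  · rw [hin]
    nlinarith [(hg a x).1, key a x]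
  · rw [hin]
    nlinarith [(hg a x).2, key a x, mul_le_mul_of_nonneg_right hε1 (sq_nonneg ‖x - a‖)]

theorem IsCompact.finite_of_forall_le_dist {X : Type*} [PseudoMetricSpace X] {K S : Set X}
    (hK : IsCompact K) (hS : S ⊆ K) {δ : ℝ} (hδ : 0 < δ)
    (hsep : ∀ x ∈ S, ∀ y ∈ S, x ≠ y → δ ≤ dist x y) : S.Finite := by
  obtain ⟨t, -, htf, ht⟩ := hK.finite_cover_balls (half_pos hδ)
  have hch : ∀ x ∈ S, ∃ y ∈ t, dist x y < δ / 2 := fun x hx => by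
    simpa using ht (hS hx)
  choose! c hct hcd using hch
  refine Finite.of_finite_image (htf.subset (image_subset_iff.2 hct)) fun x hx y hy hxy => ?_
  by_contra hne
  have := dist_triangle_right x y (c x)
  have h2 := hcd y hy
  rw [← hxy] at h2
  linarith [hsep x hx y hy hne, hcd x hx]

/-- A single layer of walls: pieces of tangent hyperplanes to one level set of `ρ`, based near the
points of a separated set `A`. -/
theorem QuadControlled.exists_layer [ProperSpace E] {ρ : E → ℝ} {G : E → E} {m : ℝ}
    (hρ : QuadControlled ρ G m) {C r : ℝ} (hC : 2 ≤ C) (hmC : 2 < m * (C - 3 / 2) ^ 2)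
    (hr : 0 < r) {A : Set E} (hA : ∀ x ∈ A, ∀ y ∈ A, x ≠ y → C * r ≤ dist x y) (c : ℝ) :
    ∃ W : Set E, IsCompact W ∧ (∀ x ∈ W, ρ x ≤ c + 4 * r ^ 2) ∧ EntireGlue {x | ρ x ≤ c} W ∧
      ∀ (γ : ℝ → E) (s t : ℝ), s ≤ t → ContinuousOn γ (Icc s t) → ρ (γ s) ≤ c →
        c + 4 * r ^ 2 ≤ ρ (γ t) → ∀ z ∈ A, (∀ u ∈ Icc s t, dist (γ u) z ≤ r / 4) →
        ∃ u ∈ Icc s t, γ u ∈ W := by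
  have hr2 : 0 < r ^ 2 := by positivity
  let S : Set E := {z ∈ A | ∃ a, dist a z ≤ r / 4 ∧ ρ a = c + r ^ 2}
  have hSex : ∀ z ∈ S, ∃ a, dist a z ≤ r / 4 ∧ ρ a = c + r ^ 2 := fun z hz => hz.2
  choose! a had haρ using hSex
  have hSfin : S.Finite := by
    refine ((hρ.compact (c + r ^ 2)).cthickening (r := r / 4)).finite_of_forall_le_dist (S := S)
      (fun z hz => mem_cthickening_of_dist_le z (a z) _ _ (haρ z hz).le ?_)
      (δ := C * r) (by positivity) fun x hx y hy => hA x hx.1 y hy.1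
    exact (dist_comm _ _).trans_le (had z hz)
  let l : E → E →L[ℂ] ℂ := fun z => innerSL ℂ (G (a z))
  let b : E → ℝ := fun z => (l z (a z)).re
  have hl : ∀ z x, (l z x).re - b z = (inner ℂ (G (a z)) (x - a z)).re := by
    intro z x
    simp [l, b]
  have hlc : ∀ z, Continuous fun x => (l z x).re := fun z =>
    Complex.continuous_re.comp (l z).continuous
  let T : E → Set E := fun z => {x | (l z x).re = b z} ∩ closedBall (a z) r
  have hT : ∀ z, IsCompact (T z) := fun z =>
    (isCompact_closedBall (a z) r).inter_left (isClosed_eq (hlc z) continuous_const)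
  have hTρ : ∀ z ∈ S, ∀ x ∈ T z, ρ x ≤ c + 3 * r ^ 2 := by
    rintro z hz x ⟨hx1, hx2⟩
    have h1 := hρ.upper (a z) x
    rw [← hl, haρ z hz] at h1
    have hx1' : (l z x).re = b z := hx1
    rw [mem_closedBall, dist_eq_norm] at hx2
    have : ‖x - a z‖ ^ 2 ≤ r ^ 2 := pow_le_pow_left₀ (norm_nonneg _) hx2 2
    linarith
  have hdist : ∀ z ∈ S, ∀ z' ∈ S, z ≠ z' → (C - 1 / 2) * r ≤ dist (a z) (a z') := by
    intro z hz z' hz' hne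
    have h1 := hA z hz.1 z' hz'.1 hne
    have h2 := dist_triangle4 z (a z) (a z') z'
    have h3 := had z hz
    have h4 := had z' hz'
    rw [dist_comm] at h3
    linarith
  refine ⟨⋃ z ∈ S, T z, hSfin.isCompact_biUnion fun z _ => hT z, ?_, ?_, ?_⟩
  · intro x hx
    obtain ⟨z, hz, hxz⟩ := mem_iUnion₂.1 hx
    linarith [hTρ z hz x hxz]
  · refine EntireGlue.biUnion (hρ.compact c) hSfin T (fun z _ => hT z) l b ?_
      (fun z _ x hx => hx.1) ?_
    · intro z hz x hx
      have h1 := hρ.lower (a z) x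
      have h2 : 0 ≤ m * ‖x - a z‖ ^ 2 := mul_nonneg hρ.pos.le (sq_nonneg _)
      have hx' : ρ x ≤ c := hx
      rw [← hl, haρ z hz] at h1
      linarith
    · intro z hz z' hz' hne x hx
      have h1 := hρ.lower (a z) x
      rw [← hl, haρ z hz] at h1
      have h2 := hTρ z' hz' x hx
      have h3 := hdist z hz z' hz' hne
      have h4 := dist_triangle_left (a z) (a z') x
      have h5 : dist x (a z') ≤ r := hx.2
      have h6 : (C - 3 / 2) * r ≤ ‖x - a z‖ := by
        rw [← dist_eq_norm]
        linarith
      have h7 : ((C - 3 / 2) * r) ^ 2 ≤ ‖x - a z‖ ^ 2 :=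
        pow_le_pow_left₀ (mul_nonneg (by linarith) hr.le) h6 2
      have h8 : 2 * r ^ 2 < m * (C - 3 / 2) ^ 2 * r ^ 2 := by gcongr
      have h9 := mul_le_mul_of_nonneg_left h7 hρ.pos.le
      nlinarith
  · intro γ s t hst hγ hs ht z hz hγz
    obtain ⟨s', hs', hs'ρ⟩ : c + r ^ 2 ∈ (fun u => ρ (γ u)) '' Icc s t :=
      intermediate_value_Icc hst (f := fun u => ρ (γ u)) (hρ.cont.comp_continuousOn hγ)
        ⟨by linarith, by linarith⟩
    have hzS : z ∈ S := ⟨hz, γ s', hγz s' hs', hs'ρ⟩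
    have hnear : ∀ u ∈ Icc s t, dist (γ u) (a z) ≤ r / 2 := by
      intro u hu
      have := dist_triangle_right (γ u) (a z) z
      linarith [hγz u hu, had z hzS]
    have hsub : Icc s' t ⊆ Icc s t := Icc_subset_Icc_left hs'.1
    obtain ⟨u, hu, hub⟩ : b z ∈ (fun u => (l z (γ u)).re) '' Icc s' t := by
      refine intermediate_value_Icc hs'.2 (f := fun u => (l z (γ u)).re)
        ((hlc z).comp_continuousOn (hγ.mono hsub)) ⟨?_, ?_⟩
      · have h1 := hρ.lower (a z) (γ s')
        have h2 : 0 ≤ m * ‖γ s' - a z‖ ^ 2 := mul_nonneg hρ.pos.le (sq_nonneg _)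
        have h3 : ρ (γ s') = c + r ^ 2 := hs'ρ
        rw [← hl, haρ z hzS] at h1
        linarith
      · have h1 := hρ.upper (a z) (γ t)
        rw [← hl, haρ z hzS, ← dist_eq_norm] at h1
        have h2 := pow_le_pow_left₀ dist_nonneg (hnear t ⟨hst, le_rfl⟩) 2
        nlinarith
    refine ⟨u, hsub hu, mem_iUnion₂.2 ⟨z, hzS, hub, ?_⟩⟩
    rw [mem_closedBall]
    linarith [hnear u (hsub hu)]

/-- Layers of walls based at several separated families of points. -/
theorem QuadControlled.exists_layers [ProperSpace E] {ρ : E → ℝ} {G : E → E} {m : ℝ}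
    (hρ : QuadControlled ρ G m) {C r : ℝ} (hC : 2 ≤ C) (hmC : 2 < m * (C - 3 / 2) ^ 2)
    (hr : 0 < r) {A : ℕ → Set E}
    (hA : ∀ k, ∀ x ∈ A k, ∀ y ∈ A k, x ≠ y → C * r ≤ dist x y) (c : ℝ) (N : ℕ) :
    ∃ W : Set E, IsCompact W ∧ (∀ x ∈ W, ρ x ≤ c + N * (4 * r ^ 2)) ∧
      EntireGlue {x | ρ x ≤ c} W ∧
      ∀ (γ : ℝ → E) (s t : ℝ), s ≤ t → ContinuousOn γ (Icc s t) → ρ (γ s) ≤ c →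
        c + N * (4 * r ^ 2) ≤ ρ (γ t) → ∀ k < N, ∀ z ∈ A k,
        (∀ u ∈ Icc s t, dist (γ u) z ≤ r / 4) → ∃ u ∈ Icc s t, γ u ∈ W := by
  have hr2 : 0 < r ^ 2 := by positivity
  induction N with
  | zero => exact ⟨∅, isCompact_empty, by simp, EntireGlue.empty _, by simp⟩
  | succ N ih =>
    obtain ⟨W, hW, hWρ, hWg, hWc⟩ := ih
    obtain ⟨V, hV, hVρ, hVg, hVc⟩ := hρ.exists_layer hC hmC hr (hA N) (c + N * (4 * r ^ 2))
    have hN : 0 ≤ (N : ℝ) * (4 * r ^ 2) := by positivity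
    refine ⟨W ∪ V, hW.union hV, ?_, hWg.union hVg (fun x (hx : ρ x ≤ c) => ?_) hWρ, ?_⟩
    · push_cast
      rintro x (hx | hx)
      · linarith [hWρ x hx]
      · linarith [hVρ x hx]
    · change ρ x ≤ _
      linarith
    · push_cast
      intro γ s t hst hγ hs ht k hk z hz hγz
      rcases Nat.lt_succ_iff_lt_or_eq.1 hk with hk | rfl
      · obtain ⟨u, hu, huW⟩ := hWc γ s t hst hγ hs (by linarith) k hk z hz hγz
        exact ⟨u, hu, Or.inl huW⟩
      · obtain ⟨u, hu, huV⟩ := hVc γ s t hst hγ (by linarith) (by linarith) z hz hγz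
        exact ⟨u, hu, Or.inr huV⟩

/-- Stacking `J` rounds of layers forces every path that avoids them to have length at least
`J * (r / 8)`. -/
theorem QuadControlled.exists_rounds [ProperSpace E] {ρ : E → ℝ} {G : E → E} {m : ℝ}
    (hρ : QuadControlled ρ G m) {C r : ℝ} (hC : 2 ≤ C) (hmC : 2 < m * (C - 3 / 2) ^ 2)
    (hr : 0 < r) {A : ℕ → Set E}
    (hA : ∀ k, ∀ x ∈ A k, ∀ y ∈ A k, x ≠ y → C * r ≤ dist x y) {N : ℕ}
    (hcov : ∀ x, ∃ k < N, ∃ z ∈ A k, dist x z ≤ r / 8) (c : ℝ) (J : ℕ) :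
    ∃ W : Set E, IsCompact W ∧ (∀ x ∈ W, ρ x ≤ c + J * (N * (4 * r ^ 2))) ∧
      EntireGlue {x | ρ x ≤ c} W ∧
      ∀ (γ : ℝ → E) (s t : ℝ), s ≤ t → ContinuousOn γ (Icc s t) → ρ (γ s) ≤ c →
        c + J * (N * (4 * r ^ 2)) ≤ ρ (γ t) → (∀ u ∈ Icc s t, γ u ∉ W) →
        J * ENNReal.ofReal (r / 8) ≤ eVariationOn γ (Icc s t) := by
  have hr2 : 0 < r ^ 2 := by positivity
  induction J with
  | zero => exact ⟨∅, isCompact_empty, by simp, EntireGlue.empty _, by simp⟩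
  | succ J ih =>
    obtain ⟨W, hW, hWρ, hWg, hWc⟩ := ih
    obtain ⟨V, hV, hVρ, hVg, hVc⟩ :=
      hρ.exists_layers hC hmC hr hA (c + J * (N * (4 * r ^ 2))) N
    have hN : 0 ≤ (N : ℝ) * (4 * r ^ 2) := by positivity
    have hJ : 0 ≤ (J : ℝ) * (N * (4 * r ^ 2)) := by positivity
    refine ⟨W ∪ V, hW.union hV, ?_, hWg.union hVg (fun x (hx : ρ x ≤ c) => ?_) hWρ, ?_⟩
    · push_cast
      rintro x (hx | hx)
      · linarith [hWρ x hx]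
      · linarith [hVρ x hx]
    · change ρ x ≤ _
      linarith
    · push_cast
      intro γ s t hst hγ hs ht hav
      obtain ⟨v, hv, hvρ⟩ : c + J * (N * (4 * r ^ 2)) ∈ (fun u => ρ (γ u)) '' Icc s t :=
        intermediate_value_Icc hst (f := fun u => ρ (γ u)) (hρ.cont.comp_continuousOn hγ)
          ⟨by linarith, by linarith⟩
      have hvρ : ρ (γ v) = c + J * (N * (4 * r ^ 2)) := hvρ
      have hsub₁ : Icc s v ⊆ Icc s t := Icc_subset_Icc_right hv.2
      have hsub₂ : Icc v t ⊆ Icc s t := Icc_subset_Icc_left hv.1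
      have h1 := hWc γ s v hv.1 (hγ.mono hsub₁) hs hvρ.ge
        fun u hu huW => hav u (hsub₁ hu) (Or.inl huW)
      have h2 : ENNReal.ofReal (r / 8) ≤ eVariationOn γ (Icc v t) := by
        obtain ⟨k, hk, z, hz, hvz⟩ := hcov (γ v)
        by_contra! hlt
        obtain ⟨u, hu, huV⟩ := hVc γ v t hv.2 (hγ.mono hsub₂) hvρ.le (by linarith) k hk z hz (by
          intro u hu
          have h3 := (eVariationOn.edist_le γ hu (left_mem_Icc.2 hv.2)).trans_lt hlt
          rw [edist_dist, ENNReal.ofReal_lt_ofReal_iff (by positivity)] at h3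
          linarith [dist_triangle (γ u) (γ v) z])
        exact hav u (hsub₂ hu) (Or.inr huV)
      have h3 := eVariationOn.Icc_add_Icc γ (s := univ) hv.1 hv.2 (mem_univ v)
      simp only [univ_inter] at h3
      rw [← h3, add_mul, one_mul]
      exact add_le_add h1 h2

/-- Finitely many translates of a sparse lattice are dense at a fixed scale, and their number does
not change under dilations. -/
theorem exists_separated_families_s19 (n : ℕ) {C : ℝ} (hC : 0 < C) {δ : ℝ} (hδ : 0 < δ) :
    ∃ N : ℕ, ∀ r : ℝ, 0 < r → ∃ A : ℕ → Set (EuclideanSpace ℂ (Fin n)),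
      (∀ k, ∀ x ∈ A k, ∀ y ∈ A k, x ≠ y → C * r ≤ dist x y) ∧
      ∀ x, ∃ k < N, ∃ z ∈ A k, dist x z ≤ δ * r := by
  let L : (Fin n → ℤ × ℤ) → EuclideanSpace ℂ (Fin n) := fun a =>
    WithLp.toLp 2 fun i => ⟨C * (a i).1, C * (a i).2⟩
  have hsep : ∀ a b, L a ≠ L b → C ≤ dist (L a) (L b) := by
    intro a b hab
    obtain ⟨i, hi⟩ : ∃ i, a i ≠ b i := by
      by_contra! h
      exact hab (by rw [funext h])
    have h1 : ‖L a i - L b i‖ ≤ dist (L a) (L b) := by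
      rw [dist_eq_norm]
      exact PiLp.norm_apply_le (L a - L b) i
    refine le_trans ?_ h1
    have hint : ∀ p q : ℤ, p ≠ q → C ≤ |C * p - C * q| := by
      intro p q hpq
      have h2 : (1 : ℝ) ≤ |(p : ℝ) - q| := by
        exact_mod_cast Int.one_le_abs (sub_ne_zero.2 hpq)
      rw [← mul_sub, abs_mul, abs_of_pos hC]
      nlinarith
    rcases eq_or_ne (a i).1 (b i).1 with h | h
    · exact (hint _ _ fun h' => hi (Prod.ext h h')).trans (Complex.abs_im_le_norm (L a i - L b i))
    · exact (hint _ _ h).trans (Complex.abs_re_le_norm (L a i - L b i))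
  have hround : ∀ x : ℝ, |x - C * round (x / C)| ≤ C := by
    intro x
    have h1 := abs_sub_round (x / C)
    have h2 : x - C * round (x / C) = C * (x / C - round (x / C)) := by
      field_simp
    rw [h2, abs_mul, abs_of_pos hC]
    nlinarith
  have hbdd : ∀ x, ∃ a, dist x (L a) ≤ √(∑ _i : Fin n, (C + C) ^ 2) := by
    intro x
    refine ⟨fun i => (round ((x i).re / C), round ((x i).im / C)), ?_⟩
    rw [EuclideanSpace.dist_eq]
    refine Real.sqrt_le_sqrt (Finset.sum_le_sum fun i _ => pow_le_pow_left₀ dist_nonneg ?_ 2)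
    rw [dist_eq_norm]
    exact (Complex.norm_le_abs_re_add_abs_im _).trans (add_le_add (hround _) (hround _))
  obtain ⟨t, -, htf, ht⟩ :=
    (isCompact_closedBall (0 : EuclideanSpace ℂ (Fin n))
      √(∑ _i : Fin n, (C + C) ^ 2)).finite_cover_balls hδ
  obtain ⟨N, f, hf⟩ : ∃ (N : ℕ) (f : ℕ → EuclideanSpace ℂ (Fin n)), ∀ y ∈ t, ∃ k < N, f k = y := by
    obtain ⟨l, hl⟩ := htf.exists_finset_coe
    refine ⟨l.toList.length, fun k => l.toList.getD k 0, fun y hy => ?_⟩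
    obtain ⟨k, hk, hky⟩ := List.getElem_of_mem (Finset.mem_toList.2 (by rwa [← hl] at hy))
    exact ⟨k, hk, (List.getD_eq_getElem _ _ hk).trans hky⟩
  refine ⟨N, fun r hr => ⟨fun k => range fun a => r • (f k + L a), ?_, fun x => ?_⟩⟩
  · rintro k _ ⟨a, rfl⟩ _ ⟨b, rfl⟩ hne
    rw [dist_smul₀, dist_add_left, Real.norm_of_nonneg hr.le, mul_comm]
    exact mul_le_mul_of_nonneg_left (hsep a b fun h => hne (by simp only [h])) hr.le
  · obtain ⟨a, ha⟩ := hbdd (r⁻¹ • x)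
    have hx : r⁻¹ • x - L a ∈ ⋃ y ∈ t, ball y δ := ht (by
      rwa [mem_closedBall_zero_iff, ← dist_eq_norm])
    obtain ⟨y, hy, hxy⟩ := mem_iUnion₂.1 hx
    obtain ⟨k, hk, rfl⟩ := hf y hy
    refine ⟨k, hk, _, ⟨a, rfl⟩, ?_⟩
    rw [mem_ball, dist_eq_norm, sub_right_comm, sub_sub] at hxy
    nth_rw 1 [← smul_inv_smul₀ hr.ne' x]
    rw [dist_smul₀, Real.norm_of_nonneg hr.le, mul_comm, dist_eq_norm]
    exact mul_le_mul_of_nonneg_right hxy.le hr.le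

/-- Around a compact convex set there is a compact system of walls, removable for the purposes of
approximation, that forces long detours. -/
theorem exists_labyrinth_s19 {n : ℕ} {D K : Set (EuclideanSpace ℂ (Fin n))} (hD : IsOpen D)
    (hK : IsCompact K) (hKc : Convex ℝ K) (hKne : K.Nonempty) (hKD : K ⊆ D) :
    ∃ W K' : Set (EuclideanSpace ℂ (Fin n)), IsCompact K' ∧ K' ⊆ D ∧ W ⊆ K' ∧
      EntireGlue K W ∧
      ∀ (γ : ℝ → EuclideanSpace ℂ (Fin n)) (s t : ℝ), s ≤ t → ContinuousOn γ (Icc s t) →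
        γ s ∈ K → γ t ∉ K' → (∀ u ∈ Icc s t, γ u ∉ W) → 1 ≤ eVariationOn γ (Icc s t) := by
  obtain ⟨δ, hδ, hδD⟩ := hK.exists_cthickening_subset_open hD hKD
  obtain ⟨R, hR, hKR⟩ : ∃ R > 0, ∀ x ∈ K, ‖x‖ ≤ R := by
    obtain ⟨R, hR⟩ := hK.isBounded.exists_norm_le
    exact ⟨max R 1, by positivity, fun x hx => (hR x hx).trans (le_max_left _ _)⟩
  set ε : ℝ := min 1 (δ ^ 2 / (2 * R ^ 2)) with hε_def
  have hε : 0 < ε := by positivity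
  have hεR : ε * R ^ 2 ≤ δ ^ 2 / 2 := by
    calc ε * R ^ 2 ≤ δ ^ 2 / (2 * R ^ 2) * R ^ 2 := by gcongr; exact min_le_right _ _
      _ = δ ^ 2 / 2 := by field_simp
  obtain ⟨G, hρ⟩ := quadControlled_infDist_sq_add hK hKc hKne hε (min_le_left _ _)
  set C : ℝ := 3 + 2 / ε with hC_def
  have hεC : 2 < ε * (C - 3 / 2) ^ 2 := by
    have h1 : ε * (2 / ε) = 2 := by field_simp
    have h2 : 0 < 2 / ε := by positivity
    rw [hC_def]
    nlinarith
  have hC : 2 ≤ C := by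
    have : 0 < 2 / ε := by positivity
    linarith
  obtain ⟨N, hN⟩ := exists_separated_families_s19 n (C := C) (by linarith) (δ := 1 / 8) (by norm_num)
  obtain ⟨p, hp⟩ := exists_nat_gt (64 * N / δ ^ 2)
  have hp0 : (0 : ℝ) < p := lt_of_le_of_lt (by positivity) hp
  obtain ⟨A, hA, hcov⟩ := hN (1 / p) (by positivity)
  obtain ⟨W, -, hWρ, hWg, hWc⟩ := hρ.exists_rounds hC hεC (r := 1 / p) (by positivity) hA
    (fun x => by simpa only [one_div_mul_eq_div] using hcov x) (δ ^ 2 / 2) (8 * p)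
  have htop : δ ^ 2 / 2 + ((8 * p : ℕ) : ℝ) * (N * (4 * (1 / p) ^ 2)) < δ ^ 2 := by
    have h1 : ((8 * p : ℕ) : ℝ) * (N * (4 * (1 / p) ^ 2)) = 32 * N / p := by
      push_cast
      field_simp
      ring
    rw [div_lt_iff₀ (by positivity)] at hp
    have h2 : 32 * N / (p : ℝ) < δ ^ 2 / 2 := by
      rw [div_lt_iff₀ hp0]
      linarith
    linarith
  have hK' : ∀ x, infDist x K ^ 2 + ε * ‖x‖ ^ 2 < δ ^ 2 → x ∈ cthickening δ K := by
    intro x hx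
    have h1 : infDist x K ^ 2 ≤ δ ^ 2 := by nlinarith [sq_nonneg ‖x‖]
    obtain ⟨y, hy, hxy⟩ := hK.exists_infDist_eq_dist hKne x
    refine mem_cthickening_of_dist_le x y _ _ hy ?_
    rw [← hxy]
    exact (pow_le_pow_iff_left₀ infDist_nonneg hδ.le two_ne_zero).1 h1
  have hKρ : ∀ x ∈ K, infDist x K ^ 2 + ε * ‖x‖ ^ 2 ≤ δ ^ 2 / 2 := by
    intro x hx
    rw [infDist_zero_of_mem hx, zero_pow two_ne_zero, zero_add]
    exact le_trans (by gcongr; exact hKR x hx) hεR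
  refine ⟨W, cthickening δ K, hK.cthickening, hδD, fun x hx => hK' x ((hWρ x hx).trans_lt htop),
    hWg.mono hKρ, fun γ s t hst hγ hs ht hav => ?_⟩
  have h1 := hWc γ s t hst hγ (hKρ _ hs) ?_ hav
  · convert h1
    rw [← ENNReal.ofReal_natCast, ← ENNReal.ofReal_mul (by positivity)]
    push_cast
    rw [show (8 : ℝ) * p * (1 / p / 8) = 1 by field_simp, ENNReal.ofReal_one]
  · by_contra! h
    exact ht (hK' _ (h.trans htop))

end Labyrinth

theorem exists_compact_convex_between {E : Type*} [NormedAddCommGroup E] [NormedSpace ℝ E]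
    [CompleteSpace E] {K D : Set E} (hK : IsCompact K) (hD : IsOpen D) (hDc : Convex ℝ D)
    (hKD : K ⊆ D) : ∃ C, IsCompact C ∧ Convex ℝ C ∧ K ⊆ C ∧ C ⊆ D := by
  obtain ⟨δ, hδ, hδD⟩ := hK.exists_thickening_subset_open hD hKD
  refine ⟨closure (convexHull ℝ K), ?_, (convex_convexHull ℝ K).closure,
    (subset_convexHull ℝ K).trans subset_closure, ?_⟩
  · exact isCompact_iff_totallyBounded_isComplete.2
      ⟨(hK.totallyBounded.convexHull).closure, isClosed_closure.isComplete⟩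
  · have hconv : Convex ℝ {y | ∀ v ∈ ball (0 : E) δ, y + v ∈ D} := by
      intro x hx y hy a b ha hb hab v hv
      have := hDc (hx v hv) (hy v hv) ha hb hab
      rwa [smul_add, smul_add, add_add_add_comm, ← add_smul, hab, one_smul] at this
    have hsub : convexHull ℝ K ⊆ {y | ∀ v ∈ ball (0 : E) δ, y + v ∈ D} :=
      convexHull_min (fun y hy v hv => hδD (mem_thickening_iff.2 ⟨y, hy, by
        simpa [dist_eq_norm] using hv⟩)) hconv
    intro x hx
    obtain ⟨y, hy, hxy⟩ := Metric.mem_closure_iff.1 hx δ hδ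
    have := hsub hy (x - y) (by rwa [mem_ball_zero_iff, ← dist_eq_norm])
    rwa [add_sub_cancel] at this

theorem exists_compact_seq_mem_nhds {X : Type*} [TopologicalSpace X] [LocallyCompactSpace X]
    [SecondCountableTopology X] {D : Set X} (hD : IsOpen D) :
    ∃ L : ℕ → Set X, (∀ k, IsCompact (L k)) ∧ (∀ k, L k ⊆ D) ∧ ∀ x ∈ D, ∃ k, L k ∈ nhds x := by
  have := hD.locallyCompactSpace
  let L := CompactExhaustion.choice D
  refine ⟨fun k => (↑) '' L k, fun k => (L.isCompact k).image continuous_subtype_val,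
    fun k => Subtype.coe_image_subset _ _, fun x hx => ?_⟩
  obtain ⟨k, hk⟩ := L.exists_mem_nhds ⟨x, hx⟩
  exact ⟨k, hD.isOpenMap_subtype_val.image_mem_nhds hk⟩

/-- An exhaustion of a convex domain by compact sets, each separated from the next by walls. -/
theorem exists_labyrinth_exhaustion {n : ℕ} {D : Set (EuclideanSpace ℂ (Fin n))}
    (hD : IsOpen D) (hDc : Convex ℝ D) (hDne : D.Nonempty) :
    ∃ K W : ℕ → Set (EuclideanSpace ℂ (Fin n)), Monotone K ∧ (∀ k, IsCompact (K k)) ∧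
      (∀ k, K k ⊆ D) ∧ (∀ x ∈ D, ∃ k, K k ∈ nhds x) ∧ (∀ k, W k ⊆ K (k + 1)) ∧
      (∀ k, EntireGlue (K k) (W k)) ∧
      ∀ (k : ℕ) (γ : ℝ → EuclideanSpace ℂ (Fin n)) (s t : ℝ), s ≤ t →
        ContinuousOn γ (Icc s t) → γ s ∈ K k → γ t ∉ K (k + 1) →
        (∀ u ∈ Icc s t, γ u ∉ W k) → 1 ≤ eVariationOn γ (Icc s t) := by
  obtain ⟨L, hL, hLD, hLn⟩ := exists_compact_seq_mem_nhds hD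
  let P : Set (EuclideanSpace ℂ (Fin n)) → Prop := fun K =>
    IsCompact K ∧ Convex ℝ K ∧ K.Nonempty ∧ K ⊆ D
  have step : ∀ (k : ℕ) (K : {K // P K}), ∃ (K' : {K // P K}) (W : Set (EuclideanSpace ℂ (Fin n))),
      K.1 ⊆ K'.1 ∧ L k ⊆ K'.1 ∧ W ⊆ K'.1 ∧ EntireGlue K.1 W ∧
      ∀ (γ : ℝ → EuclideanSpace ℂ (Fin n)) (s t : ℝ), s ≤ t → ContinuousOn γ (Icc s t) →
        γ s ∈ K.1 → γ t ∉ K'.1 → (∀ u ∈ Icc s t, γ u ∉ W) → 1 ≤ eVariationOn γ (Icc s t) := by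
    rintro k ⟨K, hK, hKc, hKne, hKD⟩
    obtain ⟨W, V, hV, hVD, hWV, hW, hWc⟩ := exists_labyrinth_s19 hD hK hKc hKne hKD
    obtain ⟨K', hK', hKc', hsub, hKD'⟩ := exists_compact_convex_between
      ((hK.union (hL k)).union hV) hD hDc (union_subset (union_subset hKD (hLD k)) hVD)
    rw [union_subset_iff, union_subset_iff] at hsub
    exact ⟨⟨K', hK', hKc', hKne.mono hsub.1.1, hKD'⟩, W, hsub.1.1, hsub.1.2, hWV.trans hsub.2, hW,
      fun γ s t hst hγ hs ht => hWc γ s t hst hγ hs fun h => ht (hsub.2 h)⟩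
  choose next wall hnext hLnext hwall hglue hcross using step
  obtain ⟨x₀, hx₀⟩ := hDne
  let K : ℕ → {K // P K} := fun k => k.rec
    ⟨{x₀}, isCompact_singleton, convex_singleton x₀, singleton_nonempty x₀,
      singleton_subset_iff.2 hx₀⟩ fun k K => next k K
  refine ⟨fun k => (K k).1, fun k => wall k (K k), monotone_nat_of_le_succ fun k => hnext k (K k),
    fun k => (K k).2.1, fun k => (K k).2.2.2.2, fun x hx => ?_, fun k => hwall k (K k),
    fun k => hglue k (K k), fun k => hcross k (K k)⟩
  obtain ⟨k, hk⟩ := hLn x hx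
  exact ⟨k + 1, Filter.mem_of_superset hk (hLnext k (K k))⟩

/-- A holomorphic function that is close to prescribed constants on each set of a sequence. -/
theorem exists_differentiableOn_near_const {E : Type*} [NormedAddCommGroup E] [NormedSpace ℂ E]
    {D : Set E} {K W : ℕ → Set E} (hmono : Monotone K) (hcover : ∀ x ∈ D, ∃ k, K k ∈ nhds x)
    (hWK : ∀ k, W k ⊆ K (k + 1)) (hglue : ∀ k, EntireGlue (K k) (W k)) (q : ℕ → ℂ) :
    ∃ F : E → ℂ, DifferentiableOn ℂ F D ∧ ∀ k, ∀ x ∈ W k, ‖F x - q k‖ ≤ 2 * (1 / 2) ^ k := by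
  have step : ∀ (k : ℕ) (g : {g : E → ℂ // Differentiable ℂ g}),
      ∃ h : {g : E → ℂ // Differentiable ℂ g},
        (∀ x ∈ K k, ‖h.1 x - g.1 x‖ < (1 / 2) ^ k) ∧ ∀ x ∈ W k, ‖h.1 x - q k‖ < (1 / 2) ^ k := by
    rintro k ⟨g, hg⟩
    obtain ⟨h, hh, hK, hW⟩ := hglue k g hg (q k) ((1 / 2) ^ k) (by positivity)
    exact ⟨⟨h, hh⟩, hK, hW⟩
  choose next hnextK hnextW using step
  let f : ℕ → {g : E → ℂ // Differentiable ℂ g} := fun k => k.rec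
    ⟨fun _ => 0, differentiable_const 0⟩ fun k g => next k g
  obtain ⟨F, hF, hFK⟩ := exists_differentiableOn_limit hmono hcover (f := fun k => (f k).1)
    (fun k => (f k).2) fun k x hx => (hnextK k (f k) x hx).le
  refine ⟨F, hF, fun k x hx => ?_⟩
  have h1 := hFK (k + 1) x (hWK k hx)
  have h2 : ‖(f (k + 1)).1 x - q k‖ < (1 / 2) ^ k := hnextW k (f k) x hx
  have h3 := norm_sub_le_norm_sub_add_norm_sub (F x) ((f (k + 1)).1 x) (q k)
  rw [pow_succ] at h1
  linarith

/-- A path leaving every `K k`, and avoiding infinitely many of the walls between them, has infinite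
length. -/
theorem eVariationOn_eq_top_of_avoids {E : Type*} [NormedAddCommGroup E] {D : Set E}
    {K W : ℕ → Set E} (hmono : Monotone K) (hK : ∀ k, IsCompact (K k)) (hKD : ∀ k, K k ⊆ D)
    (hcover : ∀ x ∈ D, ∃ k, K k ∈ nhds x)
    (hcross : ∀ (k : ℕ) (γ : ℝ → E) (s t : ℝ), s ≤ t → ContinuousOn γ (Icc s t) → γ s ∈ K k →
      γ t ∉ K (k + 1) → (∀ u ∈ Icc s t, γ u ∉ W k) → 1 ≤ eVariationOn γ (Icc s t))
    {γ : ℝ → E} (hγ : DivergentPathIn D γ)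
    (hav : ∀ m, ∃ k ≥ m, ∀ t ∈ Ico (0 : ℝ) 1, γ t ∉ W k) : eVariationOn γ (Ico 0 1) = ⊤ := by
  obtain ⟨hcont, hmem, hdiv⟩ := hγ
  have key : ∀ N : ℕ, ∃ t ∈ Ico (0 : ℝ) 1, N ≤ eVariationOn γ (Icc 0 t) := by
    intro N
    induction N with
    | zero => exact ⟨0, by simp, by simp⟩
    | succ N ih =>
      obtain ⟨t, ht, htN⟩ := ih
      obtain ⟨m, hm⟩ := hcover _ (hmem t ht)
      obtain ⟨k, hmk, hk⟩ := hav m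
      obtain ⟨t₀, ht₀, ht₀K⟩ := hdiv (K (k + 1)) (hKD _) (hK _)
      have htt : t ≤ max t t₀ := le_max_left _ _
      have hlt : max t t₀ < 1 := max_lt ht.2 ht₀.2
      have hsub : Icc t (max t t₀) ⊆ Ico 0 1 := fun u hu =>
        ⟨ht.1.trans hu.1, hu.2.trans_lt hlt⟩
      refine ⟨max t t₀, ⟨ht.1.trans htt, hlt⟩, ?_⟩
      have h1 := hcross k γ t (max t t₀) htt (hcont.mono hsub) (hmono hmk (mem_of_mem_nhds hm))
        (ht₀K _ ⟨le_max_right _ _, hlt⟩) fun u hu => hk u (hsub hu)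
      have h2 := eVariationOn.Icc_add_Icc γ (s := univ) ht.1 htt (mem_univ t)
      simp only [univ_inter] at h2
      rw [← h2]
      push_cast
      exact add_le_add htN h1
  by_contra hne
  obtain ⟨N, hN⟩ := ENNReal.exists_nat_gt hne
  obtain ⟨t, ht, htN⟩ := key N
  exact (hN.trans_le htN).not_ge
    (eVariationOn.mono γ fun u hu => ⟨hu.1, hu.2.trans_lt ht.2⟩)

/-- Charpentier–Kosiński: on every nonempty open convex domain `D ⊆ ℂⁿ` (`n ≥ 2`) there is a
holomorphic function whose image along every divergent path of finite length is dense in ℂ. -/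
theorem charpentier_kosinski_wild_boundary_behavior (n : ℕ) (hn : 2 ≤ n)
    (D : Set (EuclideanSpace ℂ (Fin n))) (hDo : IsOpen D) (hDc : Convex ℝ D)
    (hDne : D.Nonempty) :
    ∃ f : EuclideanSpace ℂ (Fin n) → ℂ,
      DifferentiableOn ℂ f D ∧
      ∀ γ : ℝ → EuclideanSpace ℂ (Fin n), DivergentPathIn D γ →
        eVariationOn γ (Set.Ico 0 1) ≠ ⊤ →
        Dense ((fun t => f (γ t)) '' Set.Ico (0 : ℝ) 1) := by
  obtain ⟨K, W, hmono, hK, hKD, hcover, hWK, hglue, hcross⟩ :=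
    exists_labyrinth_exhaustion hDo hDc hDne
  obtain ⟨F, hF, hFW⟩ := exists_differentiableOn_near_const hmono hcover hWK hglue
    fun k => TopologicalSpace.denseSeq ℂ k.unpair.1
  refine ⟨F, hF, fun γ hγ hfin => Metric.dense_iff.2 fun z ε hε => ?_⟩
  by_contra hempty
  rw [not_nonempty_iff_eq_empty] at hempty
  refine hfin (eVariationOn_eq_top_of_avoids hmono hK hKD hcover hcross hγ fun m => ?_)
  obtain ⟨j, hj⟩ : ∃ j, dist z (TopologicalSpace.denseSeq ℂ j) < ε / 2 := by
    simpa using (TopologicalSpace.denseRange_denseSeq ℂ).exists_dist_lt z (half_pos hε)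
  obtain ⟨l, hl⟩ := exists_pow_lt_of_lt_one (show 0 < ε / 4 by positivity) one_half_lt_one
  have hle : max m l ≤ Nat.pair j (max m l) := Nat.right_le_pair _ _
  refine ⟨Nat.pair j (max m l), (le_max_left _ _).trans hle, fun t ht htW => ?_⟩
  have h1 := hFW _ _ htW
  rw [Nat.unpair_pair, ← dist_eq_norm] at h1
  have h2 : (1 / 2 : ℝ) ^ Nat.pair j (max m l) ≤ (1 / 2) ^ l :=
    pow_le_pow_of_le_one (by norm_num) (by norm_num) ((le_max_right _ _).trans hle)
  refine (eq_empty_iff_forall_notMem.1 hempty) (F (γ t)) ⟨?_, mem_image_of_mem _ ht⟩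
  rw [mem_ball]
  have h3 := dist_triangle_right (F (γ t)) z (TopologicalSpace.denseSeq ℂ j)
  linarith
end
end
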